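/- arXiv:quant-ph/0605148 — 9 statements merged into one kernel-verified Lean document; each statement's English description precedes it below -/
import Mathlib

section
/- For all positive integers m and n, the no-signaling polytope X_B(m,n) equals the image of the rooted correlation semimetric polytope RCMet(K_{m,n}) under the affine map ι; that is, X_B(m,n) = ι(RCMet(K_{m,n})). -/
open Finset

/-- The no-signaling polytope `X_B(m,n)`: vectors `q` with coordinates `q i j a b`
(`a, b : Bool` encoding the outcomes, `false ↦ -1`, `true ↦ +1`) satisfying
nonnegativity, normalization and the no-signaling condition. -/
def XB (m n : ℕ) : Set (Fin m → Fin n → Bool → Bool → ℝ) :=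
  {q | (∀ i j a b, 0 ≤ q i j a b) ∧
       (∀ i j, ∑ a, ∑ b, q i j a b = 1) ∧
       (∀ i a j j', ∑ b, q i j a b = ∑ b, q i j' a b) ∧
       (∀ j b i i', ∑ a, q i j a b = ∑ a, q i' j a b)}

/-- The rooted correlation semimetric polytope `RCMet(K_{m,n})`:
`p = (pA, pB, pAB)` with `pAB i j ≥ 0`, `pA i - pAB i j ≥ 0`,
`pB j - pAB i j ≥ 0` and `1 - pA i - pB j + pAB i j ≥ 0`. -/
def RCMet (m n : ℕ) :
    Set ((Fin m → ℝ) × (Fin n → ℝ) × (Fin m → Fin n → ℝ)) :=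
  {p | ∀ i j, 0 ≤ p.2.2 i j ∧ 0 ≤ p.1 i - p.2.2 i j ∧
       0 ≤ p.2.1 j - p.2.2 i j ∧ 0 ≤ 1 - p.1 i - p.2.1 j + p.2.2 i j}

/-- The affine map `ι` sending `p` to the correlation table `q`:
`q_{-1,-1|ij} = pAB i j`, `q_{-1,+1|ij} = pA i - pAB i j`,
`q_{+1,-1|ij} = pB j - pAB i j`, `q_{+1,+1|ij} = 1 - pA i - pB j + pAB i j`. -/
def iota (m n : ℕ) (p : (Fin m → ℝ) × (Fin n → ℝ) × (Fin m → Fin n → ℝ)) :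
    Fin m → Fin n → Bool → Bool → ℝ :=
  fun i j a b =>
    match a, b with
    | false, false => p.2.2 i j
    | false, true  => p.1 i - p.2.2 i j
    | true,  false => p.2.1 j - p.2.2 i j
    | true,  true  => 1 - p.1 i - p.2.1 j + p.2.2 i j

/-- The no-signaling polytope equals the image of the rooted correlation
semimetric polytope under `ι`. -/
theorem nosignaling_eq_image_rcmet (m n : ℕ) (hm : 0 < m) (hn : 0 < n) :
    XB m n = iota m n '' RCMet m n := by
  ext q
  constructor
  · rintro ⟨hnonneg, hnorm, hA, hB⟩
    simp only [Fintype.sum_bool] at hnorm hA hB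
    let i₀ : Fin m := ⟨0, hm⟩
    let j₀ : Fin n := ⟨0, hn⟩
    have hiota : iota m n
        (fun i => q i j₀ false true + q i j₀ false false,
          fun j => q i₀ j true false + q i₀ j false false,
          fun i j => q i j false false) = q := by
      funext i j a b
      have h₁ := hnorm i j
      have h₂ := hA i false j₀ j
      have h₃ := hB j false i₀ i
      cases a <;> cases b <;> simp only [iota] <;> linarith
    refine ⟨_, fun i j => ?_, hiota⟩
    have hpos := hnonneg i j
    rw [← hiota] at hpos
    exact ⟨hpos false false, hpos false true, hpos true false, hpos true true⟩
  · rintro ⟨p, hp, rfl⟩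
    refine ⟨fun i j a b => ?_, fun i j => ?_, fun i a j j' => ?_, fun j b i i' => ?_⟩
    · obtain ⟨h₁, h₂, h₃, h₄⟩ := hp i j
      cases a <;> cases b <;> assumption
    · simp only [Fintype.sum_bool, iota]
      ring
    · cases a <;> simp only [Fintype.sum_bool, iota] <;> ring
    · cases b <;> simp only [Fintype.sum_bool, iota] <;> ring
end

section
/- Every extreme point of the no-signaling polytope X_B(m,n) has all of its 4mn coordinates in the set {0, 1/2, 1}. -/
open Finset

/-- A cubic that is odd about `1/2` and vanishes exactly at `0`, `1/2` and `1`. -/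
def oddCubic (x : ℝ) : ℝ := x * (1 - x) * (1 - 2 * x)

theorem oddCubic_eq_zero_iff {x : ℝ} : oddCubic x = 0 ↔ x = 0 ∨ x = 1 / 2 ∨ x = 1 := by
  unfold oddCubic
  constructor
  · intro h
    rcases mul_eq_zero.1 h with h | h
    · rcases mul_eq_zero.1 h with h | h
      · exact Or.inl h
      · exact Or.inr (Or.inr (by linarith))
    · exact Or.inr (Or.inl (by linarith))
  · rintro (rfl | rfl | rfl) <;> norm_num

/-- A direction in the space of `2 × 2` tables that respects the support of a probability table
and whose marginals are the images of the marginals of the table under `oddCubic`. It vanishes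
only if the table is half-integral. -/
theorem exists_direction (p : Bool → Bool → ℝ) (hp : ∀ a b, 0 ≤ p a b)
    (hs : ∑ a, ∑ b, p a b = 1) :
    ∃ d : Bool → Bool → ℝ,
      (∀ a, ∑ b, d a b = oddCubic (∑ b, p a b)) ∧
      (∀ b, ∑ a, d a b = oddCubic (∑ a, p a b)) ∧
      (∀ a b, p a b = 0 → d a b = 0) ∧
      ((∀ a b, d a b = 0) → ∀ a b, p a b ∈ ({0, 1/2, 1} : Set ℝ)) := by
  obtain ⟨t, ht⟩ : ∃ t, t = p true true := ⟨_, rfl⟩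
  obtain ⟨x, hx⟩ : ∃ x, x = p true true + p true false := ⟨_, rfl⟩
  obtain ⟨y, hy⟩ : ∃ y, y = p true true + p false true := ⟨_, rfl⟩
  simp only [Fintype.sum_bool] at hs
  have htf : p true false = x - t := by linarith
  have hft : p false true = y - t := by linarith
  have hff : p false false = 1 - x - y + t := by linarith
  have h1 := hp true true
  have h2 := hp true false
  have h3 := hp false true
  have h4 := hp false false
  rw [← ht] at h1
  rw [htf] at h2
  rw [hft] at h3
  rw [hff] at h4
  obtain ⟨e, e1, e2, e3, e4, e5⟩ : ∃ e : ℝ, (t = 0 → e = 0) ∧ (x - t = 0 → oddCubic x - e = 0) ∧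
      (y - t = 0 → oddCubic y - e = 0) ∧
      (1 - x - y + t = 0 → e - oddCubic x - oddCubic y = 0) ∧
      (e = 0 → t = 0 ∨ t = x ∨ t = y ∨ t = x + y - 1) := by
    by_cases c1 : t = 0
    · subst c1
      refine ⟨0, fun _ => rfl, fun h => ?_, fun h => ?_, fun h => ?_, fun _ => Or.inl rfl⟩
      · rw [show x = 0 by linarith]; simp [oddCubic]
      · rw [show y = 0 by linarith]; simp [oddCubic]
      · rw [show y = 1 - x by linarith]; unfold oddCubic; ring
    by_cases c2 : t = x
    · subst c2
      refine ⟨oddCubic t, fun h => absurd h c1, fun _ => sub_self _, fun h => ?_, fun h => ?_,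
        fun _ => Or.inr (Or.inl rfl)⟩
      · rw [show y = t by linarith]; ring
      · rw [show y = 1 by linarith]; unfold oddCubic; ring
    by_cases c3 : t = y
    · subst c3
      refine ⟨oddCubic t, fun h => absurd h c1, fun h => absurd (by linarith) c2,
        fun _ => sub_self _, fun h => ?_, fun _ => Or.inr (Or.inr (Or.inl rfl))⟩
      rw [show x = 1 by linarith]; unfold oddCubic; ring
    by_cases c4 : t = x + y - 1
    · exact ⟨oddCubic x + oddCubic y, fun h => absurd h c1, fun h => absurd (by linarith) c2,
        fun h => absurd (by linarith) c3, fun _ => by ring, fun _ => Or.inr (Or.inr (Or.inr c4))⟩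
    · exact ⟨1, fun h => absurd h c1, fun h => absurd (by linarith) c2,
        fun h => absurd (by linarith) c3, fun h => absurd (by linarith) c4,
        fun h => absurd h one_ne_zero⟩
  refine ⟨fun a b => cond a (cond b e (oddCubic x - e))
    (cond b (oddCubic y - e) (e - oddCubic x - oddCubic y)), ?_, ?_, ?_, ?_⟩
  · rintro (_ | _) <;> simp only [Fintype.sum_bool, cond, htf, hft, hff, ← ht] <;>
      unfold oddCubic <;> ring
  · rintro (_ | _) <;> simp only [Fintype.sum_bool, cond, htf, hft, hff, ← ht] <;>
      unfold oddCubic <;> ring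
  · rintro (_ | _) (_ | _) <;> simp only [cond, htf, hft, hff, ← ht] <;> assumption
  · intro h
    have he : e = 0 := h true true
    have hx0 : oddCubic x - e = 0 := h true false
    have hy0 : oddCubic y - e = 0 := h false true
    rw [he, sub_zero, oddCubic_eq_zero_iff] at hx0 hy0
    have htv := e5 he
    rintro (_ | _) (_ | _) <;>
      simp only [htf, hft, hff, ← ht, Set.mem_insert_iff, Set.mem_singleton_iff] <;>
      rcases hx0 with rfl | rfl | rfl <;> rcases hy0 with rfl | rfl | rfl <;>
      rcases htv with rfl | rfl | rfl | rfl <;>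
      first | (exfalso; linarith) | norm_num

/-- A direction that is tangent to the no-signaling polytope and respects the support of an
extreme point vanishes. -/
theorem direction_eq_zero_of_mem_extremePoints {m n : ℕ}
    {q d : Fin m → Fin n → Bool → Bool → ℝ} (hq : q ∈ Set.extremePoints ℝ (XB m n))
    (hd : ∀ i j, ∑ a, ∑ b, d i j a b = 0)
    (hA : ∀ i a j j', ∑ b, d i j a b = ∑ b, d i j' a b)
    (hB : ∀ j b i i', ∑ a, d i j a b = ∑ a, d i' j a b)
    (h0 : ∀ i j a b, q i j a b = 0 → d i j a b = 0) : d = 0 := by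
  rw [mem_extremePoints] at hq
  obtain ⟨⟨q1, q2, q3, q4⟩, hext⟩ := hq
  have hev : ∀ᶠ ε : ℝ in nhdsWithin 0 (Set.Ioi 0), ∀ i j a b, ε * |d i j a b| ≤ q i j a b := by
    simp only [Filter.eventually_all]
    intro i j a b
    rcases (q1 i j a b).eq_or_lt with h | h
    · simp [h0 i j a b h.symm, q1 i j a b]
    · have hc : Filter.Tendsto (fun ε : ℝ => ε * |d i j a b|) (nhds 0) (nhds (0 * |d i j a b|)) :=
        (continuous_id.mul continuous_const).tendsto 0
      rw [zero_mul] at hc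
      exact ((hc.eventually (gt_mem_nhds h)).filter_mono nhdsWithin_le_nhds).mono
        fun _ => le_of_lt
  obtain ⟨ε, hε, hpos⟩ := (hev.and self_mem_nhdsWithin).exists
  have key : ∀ s : ℝ, |s| = ε → q + s • d ∈ XB m n := by
    intro s hs
    refine ⟨fun i j a b => ?_, fun i j => ?_, fun i a j j' => ?_, fun j b i i' => ?_⟩
    · have h1 := hε i j a b
      rw [← hs, ← abs_mul] at h1
      have h2 := neg_abs_le (s * d i j a b)
      simp only [Pi.add_apply, Pi.smul_apply, smul_eq_mul]
      linarith
    · simp only [Pi.add_apply, Pi.smul_apply, smul_eq_mul, sum_add_distrib, ← mul_sum, hd, q2]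
      ring
    · simp only [Pi.add_apply, Pi.smul_apply, smul_eq_mul, sum_add_distrib, ← mul_sum]
      rw [hA i a j j', q3 i a j j']
    · simp only [Pi.add_apply, Pi.smul_apply, smul_eq_mul, sum_add_distrib, ← mul_sum]
      rw [hB j b i i', q4 j b i i']
  have h := hext _ (key ε (abs_of_pos hpos)) _ (key (-ε) (by rw [abs_neg, abs_of_pos hpos]))
    ⟨1 / 2, 1 / 2, by norm_num, by norm_num, by norm_num, by module⟩
  simpa [hpos.ne'] using h.1

/-- Every extreme point of the no-signaling polytope has all its
coordinates in `{0, 1/2, 1}`. -/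
theorem extremePoints_XB_coords (m n : ℕ) (hm : 0 < m) (hn : 0 < n)
    (q : Fin m → Fin n → Bool → Bool → ℝ)
    (hq : q ∈ Set.extremePoints ℝ (XB m n)) :
    ∀ i j a b, q i j a b ∈ ({0, 1/2, 1} : Set ℝ) := by
  obtain ⟨q1, q2, q3, q4⟩ := hq.1
  choose d dA dB d0 dhalf using fun i j => exists_direction (q i j) (q1 i j) (q2 i j)
  have hd : d = 0 := by
    refine direction_eq_zero_of_mem_extremePoints hq (fun i j => ?_) (fun i a j j' => ?_)
      (fun j b i i' => ?_) d0
    · have h := q2 i j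
      simp only [dA]
      rw [Fintype.sum_bool] at h ⊢
      rw [eq_sub_of_add_eq h]
      unfold oddCubic
      ring
    · rw [dA, dA, q3 i a j j']
    · rw [dB, dB, q4 j b i i']
  intro i j
  exact dhalf i j fun a b => by rw [hd]; rfl
end

section
/- A vector x ∈ ℝ^{m×n} belongs to the elliptope E(K_{m,n}) if and only if there exists a finite-dimensional quantum realization (d_A, d_B, ρ, A_1,…,A_m, B_1,…,B_n) such that x_{ij} = tr(ρ (A_i ⊗ B_j)) for all 1 ≤ i ≤ m and 1 ≤ j ≤ n, where ⊗ denotes the Kronecker product. -/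
open Finset Matrix Kronecker ComplexOrder

/-- For every `d` there are `d` pairwise anticommuting Hermitian involutive complex matrices. -/
theorem exists_anticommuting_involutions (d : ℕ) :
    ∃ (N : ℕ) (C : Fin d → Matrix (Fin N) (Fin N) ℂ), 0 < N ∧
      (∀ k, (C k).IsHermitian) ∧ (∀ k, C k * C k = 1) ∧
      (∀ k l, k ≠ l → C k * C l + C l * C k = 0) := by
  induction d with
  | zero => exact ⟨1, fun k => k.elim0, one_pos, fun k => k.elim0, fun k => k.elim0,
      fun k => k.elim0⟩
  | succ d ih =>
    obtain ⟨N, C, hN, hH, hI, hC⟩ := ih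
    let D : Fin (d + 1) → Matrix (Fin N ⊕ Fin N) (Fin N ⊕ Fin N) ℂ :=
      Fin.cons (fromBlocks 1 0 0 (-1)) (fun k => fromBlocks 0 (C k) (C k) 0)
    have hDH : ∀ k, (D k).IsHermitian := by
      intro k
      refine Fin.cases ?_ (fun k => ?_) k
      · simp [D, IsHermitian, fromBlocks_conjTranspose]
      · simp [D, IsHermitian, fromBlocks_conjTranspose, (hH k).eq]
    have hDI : ∀ k, D k * D k = 1 := by
      intro k
      refine Fin.cases ?_ (fun k => ?_) k
      · simp [D, fromBlocks_multiply]
      · simp [D, fromBlocks_multiply, hI]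
    have hDC : ∀ k l, k ≠ l → D k * D l + D l * D k = 0 := by
      intro k l
      refine Fin.cases ?_ (fun k => ?_) k <;> refine Fin.cases ?_ (fun l => ?_) l
      · simp
      · simp [D, fromBlocks_multiply, fromBlocks_add]
      · simp [D, fromBlocks_multiply, fromBlocks_add]
      · intro h
        have h' := hC k l (fun e => h (by rw [e]))
        simp [D, fromBlocks_multiply, fromBlocks_add, h']
    let e := reindexAlgEquiv ℂ ℂ (finSumFinEquiv (m := N) (n := N))
    refine ⟨N + N, fun k => e (D k), by omega, fun k => ?_, fun k => ?_, fun k l h => ?_⟩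
    · exact (hDH k).submatrix _
    · rw [← map_mul, hDI, map_one]
    · rw [← map_mul, ← map_mul, ← map_add, hDC k l h, map_zero]

/-- The trace form of real combinations of anticommuting involutions. -/
theorem trace_sum_smul_mul_sum_smul {d N : ℕ} {C : Fin d → Matrix (Fin N) (Fin N) ℂ}
    (hI : ∀ k, C k * C k = 1) (hC : ∀ k l, k ≠ l → C k * C l + C l * C k = 0)
    (u v : Fin d → ℝ) :
    ((∑ k, (u k : ℂ) • C k) * ∑ k, (v k : ℂ) • C k).trace = N * ((∑ k, u k * v k : ℝ) : ℂ) := by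
  have htr : ∀ k l, (C k * C l).trace = if k = l then (N : ℂ) else 0 := by
    intro k l
    split_ifs with h
    · subst h; simp [hI]
    · have h1 := congrArg trace (hC k l h)
      rw [trace_add, trace_mul_comm (C l), trace_zero] at h1
      linear_combination h1 / 2
  simp only [Finset.sum_mul, Finset.mul_sum, trace_sum, smul_mul_smul_comm, trace_smul, htr,
    smul_eq_mul, mul_ite, mul_zero, Finset.sum_ite_eq', Finset.mem_univ,
    if_true]
  push_cast
  simp [Finset.mul_sum, mul_comm]

/-- A unit real combination of anticommuting involutions is an involution. -/
theorem sum_smul_mul_self_eq_one {d N : ℕ} {C : Fin d → Matrix (Fin N) (Fin N) ℂ}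
    (hI : ∀ k, C k * C k = 1) (hC : ∀ k l, k ≠ l → C k * C l + C l * C k = 0)
    {u : Fin d → ℝ} (hu : ∑ k, u k * u k = 1) :
    (∑ k, (u k : ℂ) • C k) * ∑ k, (u k : ℂ) • C k = 1 := by
  have hsym : ∀ k l, C k * C l + C l * C k =
      if k = l then (2 : ℂ) • (1 : Matrix (Fin N) (Fin N) ℂ) else 0 := by
    intro k l
    split_ifs with h
    · subst h; rw [hI, two_smul]
    · exact hC k l h
  set S := (∑ k, (u k : ℂ) • C k) * ∑ k, (u k : ℂ) • C k with hS
  have h1 : S = ∑ k, ∑ l, ((u k : ℂ) * u l) • (C k * C l) := by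
    simp only [hS, Finset.sum_mul, Finset.mul_sum, smul_mul_smul_comm]
    exact Finset.sum_comm
  have h2 : S = ∑ k, ∑ l, ((u k : ℂ) * u l) • (C l * C k) := by
    rw [h1, Finset.sum_comm]
    exact Finset.sum_congr rfl fun k _ => Finset.sum_congr rfl fun l _ => by
      rw [mul_comm (u l : ℂ)]
  have h3 : S + S = (2 : ℂ) • (1 : Matrix (Fin N) (Fin N) ℂ) := by
    nth_rewrite 1 [h1]
    rw [h2]
    have hu' : ∑ k, (u k : ℂ) * u k = 1 := by exact_mod_cast hu
    simp only [← Finset.sum_add_distrib, ← smul_add, hsym, smul_ite, smul_zero,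
      Finset.sum_ite_eq, Finset.mem_univ, if_true, ← Finset.sum_smul, hu', one_smul]
  rw [← two_smul ℂ S] at h3
  exact smul_right_injective _ (two_ne_zero' ℂ) h3

theorem posSemidef_one_sub_of_involution {κ : Type*} [Fintype κ] [DecidableEq κ]
    {A : Matrix κ κ ℂ} (hA : A.IsHermitian) (h : A * A = 1) : (1 - A).PosSemidef := by
  have h1 := posSemidef_conjTranspose_mul_self (1 - A)
  have h2 : (1 - A)ᴴ * (1 - A) = (2 : ℂ) • (1 - A) := by
    rw [conjTranspose_sub, conjTranspose_one, hA.eq, sub_mul, one_mul, mul_sub, h, mul_one,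
      two_smul]
    abel
  have h3 : (1 - A) = (1 / 2 : ℂ) • ((1 - A)ᴴ * (1 - A)) := by
    rw [h2, smul_smul]; norm_num
  rw [h3]
  exact h1.smul (by positivity)

theorem posSemidef_one_add_of_involution {κ : Type*} [Fintype κ] [DecidableEq κ]
    {A : Matrix κ κ ℂ} (hA : A.IsHermitian) (h : A * A = 1) : (1 + A).PosSemidef := by
  have := posSemidef_one_sub_of_involution hA.neg (by rw [neg_mul_neg, h])
  rwa [sub_neg_eq_add] at this

theorem posSemidef_one_sub_mul_self {κ : Type*} [Fintype κ] [DecidableEq κ]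
    {A : Matrix κ κ ℂ} (hA : A.IsHermitian) (h₁ : (1 - A).PosSemidef)
    (h₂ : (1 + A).PosSemidef) : (1 - A * A).PosSemidef := by
  have e : 1 - A * A = (1 / 2 : ℂ) •
      ((1 - A)ᴴ * (1 + A) * (1 - A) + (1 + A)ᴴ * (1 - A) * (1 + A)) := by
    have : (1 - A)ᴴ * (1 + A) * (1 - A) + (1 + A)ᴴ * (1 - A) * (1 + A) =
        (2 : ℂ) • (1 - A * A) := by
      rw [conjTranspose_sub, conjTranspose_add, conjTranspose_one, hA.eq, two_smul]
      noncomm_ring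
    rw [this, smul_smul]; norm_num
  rw [e]
  exact ((h₂.conjTranspose_mul_mul_same _).add (h₁.conjTranspose_mul_mul_same _)).smul
    (by positivity)

open scoped MatrixOrder Matrix.Norms.L2Operator in
theorem exists_eq_conjTranspose_mul_self {𝕜 κ : Type*} [RCLike 𝕜] [Fintype κ] [DecidableEq κ]
    {M : Matrix κ κ 𝕜} (hM : M.PosSemidef) : ∃ S : Matrix κ κ 𝕜, M = Sᴴ * S :=
  CStarAlgebra.nonneg_iff_eq_star_mul_self.mp hM.nonneg

/-- The maximally entangled state on `ℂ^N ⊗ ℂ^N`. -/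
noncomputable def maxEntangledState (N : ℕ) : Matrix (Fin N × Fin N) (Fin N × Fin N) ℂ :=
  (1 / N : ℂ) • vecMulVec (fun p => if p.1 = p.2 then 1 else 0)
    (star fun p => if p.1 = p.2 then 1 else 0)

theorem maxEntangledState_posSemidef (N : ℕ) : (maxEntangledState N).PosSemidef :=
  (posSemidef_vecMulVec_self_star _).smul (by positivity)

theorem trace_maxEntangledState_mul_kronecker_transpose (N : ℕ)
    (A B : Matrix (Fin N) (Fin N) ℂ) :
    (maxEntangledState N * (A ⊗ₖ Bᵀ)).trace = (1 / N : ℂ) * (A * B).trace := by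
  rw [maxEntangledState, smul_mul_assoc, trace_smul, smul_eq_mul]
  congr 1
  simp only [trace, diag_apply, mul_apply, vecMulVec_apply, kroneckerMap_apply, transpose_apply,
    Fintype.sum_prod_type, Pi.star_apply]
  simp [apply_ite, Finset.sum_ite_eq, ite_mul]
  exact Finset.sum_comm

/-- The real coordinates of a complex matrix in the Hilbert–Schmidt space. -/
def realCoords {κ : Type*} (M : Matrix κ κ ℂ) : (κ × κ) ⊕ (κ × κ) → ℝ :=
  Sum.elim (fun p => (M p.1 p.2).re) (fun p => (M p.1 p.2).im)

theorem realCoords_dotProduct {κ : Type*} [Fintype κ] (M M' : Matrix κ κ ℂ) :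
    realCoords M ⬝ᵥ realCoords M' = (M * M'ᴴ).trace.re := by
  simp [realCoords, dotProduct, trace, mul_apply, Fintype.sum_prod_type, Finset.sum_add_distrib]

/-- Vectors in the unit ball have the same off-diagonal inner products as unit vectors in a space
whose dimension is the number of vectors. -/
theorem exists_unit_vectors_of_unit_ball {ι κ : Type*} [Fintype ι] [DecidableEq ι] [Fintype κ]
    (w : ι → κ → ℝ) (hw : ∀ i, w i ⬝ᵥ w i ≤ 1) :
    ∃ z : ι → ι → ℝ, (∀ i, z i ⬝ᵥ z i = 1) ∧ ∀ i j, i ≠ j → z i ⬝ᵥ z j = w i ⬝ᵥ w j := by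
  have h : ((of w) * (of w)ᴴ + diagonal fun i => 1 - w i ⬝ᵥ w i).PosSemidef :=
    (posSemidef_self_mul_conjTranspose _).add
      (posSemidef_diagonal_iff.2 fun i => sub_nonneg.2 (hw i))
  obtain ⟨S, hS⟩ := exists_eq_conjTranspose_mul_self h
  have key : ∀ i j, (fun k => S k i) ⬝ᵥ (fun k => S k j) =
      w i ⬝ᵥ w j + if i = j then 1 - w i ⬝ᵥ w i else 0 := by
    intro i j
    have := congrFun (congrFun hS i) j
    simp only [Matrix.add_apply, mul_apply, conjTranspose_apply, of_apply, star_trivial,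
      diagonal_apply] at this
    exact this.symm
  refine ⟨fun i k => S k i, fun i => ?_, fun i j hij => ?_⟩
  · rw [key]; simp
  · rw [key]; simp [hij]

theorem realCoords_dotProduct_self_le_one {κ : Type*} [Fintype κ] [DecidableEq κ]
    {R T : Matrix κ κ ℂ} (hR : (Rᴴ * R).trace = 1) (hT : T.IsHermitian)
    (h : (1 - T * T).PosSemidef) : realCoords (R * T) ⬝ᵥ realCoords (R * T) ≤ 1 := by
  have h1 := (h.mul_mul_conjTranspose_same R).trace_nonneg
  have e : R * (1 - T * T) * Rᴴ = R * Rᴴ - (R * T) * (R * T)ᴴ := by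
    rw [conjTranspose_mul, hT.eq]; noncomm_ring
  rw [e, trace_sub, trace_mul_comm R, hR] at h1
  have h2 := (Complex.le_def.1 h1).1
  rw [realCoords_dotProduct]
  simpa using h2

/-- Tsirelson-type characterization: a vector `x ∈ ℝ^{m×n}` belongs to the
elliptope `E(K_{m,n})` (realized by inner products of unit vectors in `ℝ^{m+n}`)
if and only if it is realized by a finite-dimensional quantum realization
`(d_A, d_B, ρ, A_1,…,A_m, B_1,…,B_n)` via `x i j = tr (ρ (A_i ⊗ B_j))`. -/
theorem elliptope_iff_quantum (m n : ℕ) (x : Fin m → Fin n → ℝ) :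
    (∃ (u : Fin m → (Fin (m + n) → ℝ)) (v : Fin n → (Fin (m + n) → ℝ)),
        (∀ i, ∑ k, u i k * u i k = 1) ∧ (∀ j, ∑ k, v j k * v j k = 1) ∧
        (∀ i j, x i j = ∑ k, u i k * v j k)) ↔
    (∃ (dA dB : ℕ), 0 < dA ∧ 0 < dB ∧
      ∃ (ρ : Matrix (Fin dA × Fin dB) (Fin dA × Fin dB) ℂ)
        (A : Fin m → Matrix (Fin dA) (Fin dA) ℂ)
        (B : Fin n → Matrix (Fin dB) (Fin dB) ℂ),
        ρ.PosSemidef ∧ ρ.trace = 1 ∧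
        (∀ i, (A i).IsHermitian) ∧ (∀ j, (B j).IsHermitian) ∧
        (∀ i, (1 - A i).PosSemidef) ∧ (∀ i, (1 + A i).PosSemidef) ∧
        (∀ j, (1 - B j).PosSemidef) ∧ (∀ j, (1 + B j).PosSemidef) ∧
        (∀ i j, (x i j : ℂ) = (ρ * (A i ⊗ₖ B j)).trace)) := by
  constructor
  · rintro ⟨u, v, hu, hv, hx⟩
    obtain ⟨N, C, hN, hH, hI, hC⟩ := exists_anticommuting_involutions (m + n)
    have hN' : (N : ℂ) ≠ 0 := by exact_mod_cast hN.ne'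
    have herm : ∀ c : Fin (m + n) → ℝ, (∑ k, (c k : ℂ) • C k).IsHermitian := by
      intro c
      simp [IsHermitian, conjTranspose_sum, conjTranspose_smul, (hH _).eq]
    have hBH : ∀ j, ((∑ k, (v j k : ℂ) • C k)ᵀ).IsHermitian := fun j => (herm _).transpose
    have hA2 := fun i => sum_smul_mul_self_eq_one hI hC (hu i)
    have hB2 : ∀ j, (∑ k, (v j k : ℂ) • C k)ᵀ * (∑ k, (v j k : ℂ) • C k)ᵀ = 1 := fun j => by
      rw [← transpose_mul, sum_smul_mul_self_eq_one hI hC (hv j), transpose_one]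
    refine ⟨N, N, hN, hN, maxEntangledState N, fun i => ∑ k, (u i k : ℂ) • C k,
      fun j => (∑ k, (v j k : ℂ) • C k)ᵀ, maxEntangledState_posSemidef N, ?_,
      fun i => herm _, hBH,
      fun i => posSemidef_one_sub_of_involution (herm _) (hA2 i),
      fun i => posSemidef_one_add_of_involution (herm _) (hA2 i),
      fun j => posSemidef_one_sub_of_involution (hBH j) (hB2 j),
      fun j => posSemidef_one_add_of_involution (hBH j) (hB2 j), fun i j => ?_⟩
    · have := trace_maxEntangledState_mul_kronecker_transpose N 1 1
      rw [transpose_one, one_kronecker_one, mul_one, mul_one, trace_one, Fintype.card_fin] at this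
      rw [this, one_div_mul_cancel hN']
    · rw [trace_maxEntangledState_mul_kronecker_transpose, trace_sum_smul_mul_sum_smul hI hC,
        hx i j, ← mul_assoc, one_div_mul_cancel hN', one_mul]
  · rintro ⟨dA, dB, -, -, ρ, A, B, hρ, htr, hAH, hBH, hA₁, hA₂, hB₁, hB₂, hx⟩
    obtain ⟨R, rfl⟩ := exists_eq_conjTranspose_mul_self hρ
    let T : Fin m ⊕ Fin n → Matrix (Fin dA × Fin dB) (Fin dA × Fin dB) ℂ :=
      Sum.elim (fun i => A i ⊗ₖ 1) (fun j => 1 ⊗ₖ B j)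
    have hTH : ∀ s, (T s).IsHermitian := by
      rintro (i | j)
      · simp [T, IsHermitian, conjTranspose_kronecker, (hAH i).eq]
      · simp [T, IsHermitian, conjTranspose_kronecker, (hBH j).eq]
    have hT : ∀ s, (1 - T s * T s).PosSemidef := by
      rintro (i | j)
      · have := (posSemidef_one_sub_mul_self (hAH i) (hA₁ i) (hA₂ i)).kronecker
          (PosSemidef.one (n := Fin dB) (R := ℂ))
        have e : (1 - A i * A i) ⊗ₖ (1 : Matrix (Fin dB) (Fin dB) ℂ) = 1 - (A i * A i) ⊗ₖ 1 := by
          rw [eq_sub_iff_add_eq, ← add_kronecker, sub_add_cancel, one_kronecker_one]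
        rw [e] at this
        simpa [T, ← mul_kronecker_mul] using this
      · have := (PosSemidef.one (n := Fin dA) (R := ℂ)).kronecker
          (posSemidef_one_sub_mul_self (hBH j) (hB₁ j) (hB₂ j))
        have e : (1 : Matrix (Fin dA) (Fin dA) ℂ) ⊗ₖ (1 - B j * B j) = 1 - 1 ⊗ₖ (B j * B j) := by
          rw [eq_sub_iff_add_eq, ← kronecker_add, sub_add_cancel, one_kronecker_one]
        rw [e] at this
        simpa [T, ← mul_kronecker_mul] using this
    obtain ⟨z, hz, hzz⟩ := exists_unit_vectors_of_unit_ball (fun s => realCoords (R * T s))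
      fun s => realCoords_dotProduct_self_le_one htr (hTH s) (hT s)
    let e : Fin (m + n) ≃ Fin m ⊕ Fin n := finSumFinEquiv.symm
    have hsum : ∀ s t, ∑ k, z s (e k) * z t (e k) = z s ⬝ᵥ z t := fun s t =>
      e.sum_comp fun k => z s k * z t k
    refine ⟨fun i k => z (.inl i) (e k), fun j k => z (.inr j) (e k),
      fun i => (hsum _ _).trans (hz _), fun j => (hsum _ _).trans (hz _), fun i j => ?_⟩
    rw [hsum, hzz _ _ Sum.inl_ne_inr, realCoords_dotProduct]
    have h1 : A i ⊗ₖ B j = T (.inl i) * T (.inr j) := by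
      simp [T, ← mul_kronecker_mul]
    have h2 : (R * T (.inl i) * (R * T (.inr j))ᴴ).trace = (x i j : ℂ) := by
      rw [hx, h1, conjTranspose_mul, (hTH _).eq, ← mul_assoc, trace_mul_comm]
      simp only [mul_assoc]
    rw [h2, Complex.ofReal_re]
end

section
/- Let x ∈ ℝ^{(m+n)+mn} belong to the elliptope E(∇K_{m,n}) of the suspension graph. Then the vector q ∈ ℝ^{(2m)×(2n)}, with coordinates indexed by pairs ((a,i),(b,j)) for a,b ∈ {−1,+1}, 1 ≤ i ≤ m, 1 ≤ j ≤ n, defined by q_{(a,i),(b,j)} = (1 + a·x_{XA_i} + b·x_{XB_j} + ab·x_{A_iB_j})/4, belongs to the elliptope E(K_{2m,2n}). -/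
open Finset

/-- Encoding of a sign `a ∈ {−1,+1}` by a Boolean: `false ↦ -1`, `true ↦ +1`. -/
def sgn (a : Bool) : ℝ := if a then 1 else -1

/-- The elliptope `E(∇K_{m,n})` of the suspension graph. -/
def EllSusp (m n : ℕ) :
    Set ((Fin m → ℝ) × (Fin n → ℝ) × (Fin m → Fin n → ℝ)) :=
  {x | ∃ (w : Fin (1 + m + n) → ℝ) (u : Fin m → (Fin (1 + m + n) → ℝ))
        (v : Fin n → (Fin (1 + m + n) → ℝ)),
      (∑ k, w k * w k = 1) ∧ (∀ i, ∑ k, u i k * u i k = 1) ∧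
      (∀ j, ∑ k, v j k * v j k = 1) ∧
      (∀ i, x.1 i = ∑ k, w k * u i k) ∧
      (∀ j, x.2.1 j = ∑ k, w k * v j k) ∧
      (∀ i j, x.2.2 i j = ∑ k, u i k * v j k)}

/-- The elliptope `E(K_{2m,2n})` of the complete bipartite graph whose left
nodes are pairs `(a, i)` and right nodes pairs `(b, j)`: coordinates realized by
inner products of unit vectors in `ℝ^{2m+2n}`. -/
def EllK2 (m n : ℕ) : Set ((Bool × Fin m) → (Bool × Fin n) → ℝ) :=
  {q | ∃ (u : Bool × Fin m → (Fin (2 * m + 2 * n) → ℝ))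
        (v : Bool × Fin n → (Fin (2 * m + 2 * n) → ℝ)),
      (∀ p, ∑ k, u p k * u p k = 1) ∧ (∀ r, ∑ k, v r k * v r k = 1) ∧
      (∀ p r, q p r = ∑ k, u p k * v r k)}

open scoped MatrixOrder Matrix.Norms.L2Operator in
/-- A finite family of vectors can be replaced, keeping all inner products, by a family in the
Euclidean space whose dimension is the number of vectors. -/
theorem exists_same_gram {ι κ : Type*} [Fintype ι] [Fintype κ] {N : ℕ}
    (hN : Fintype.card ι = N) (F : ι → κ → ℝ) :
    ∃ g : ι → Fin N → ℝ, ∀ s t, ∑ k, g s k * g t k = ∑ k, F s k * F t k := by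
  classical
  have hpsd := Matrix.posSemidef_self_mul_conjTranspose (Matrix.of F)
  obtain ⟨B, hB⟩ := CStarAlgebra.nonneg_iff_eq_star_mul_self.mp hpsd.nonneg
  let e : Fin N ≃ ι := (Fintype.equivFinOfCardEq hN).symm
  refine ⟨fun s k => B (e k) s, fun s t => ?_⟩
  have h := congrFun (congrFun hB s) t
  simp only [Matrix.star_eq_conjTranspose, Matrix.mul_apply, Matrix.conjTranspose_apply, Matrix.of_apply, star_trivial] at h
  rw [h]
  exact e.sum_comp fun k => B k s * B k t

theorem sgn_mul_self (a : Bool) : sgn a * sgn a = 1 := by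
  cases a <;> simp [sgn]

/-- The midpoint of a unit vector and a signed unit vector has norm at most one. -/
theorem sum_midpoint_sq_le_one {κ : Type*} [Fintype κ] {w u : κ → ℝ}
    (hw : ∑ k, w k * w k = 1) (hu : ∑ k, u k * u k = 1) (a : Bool) :
    ∑ k, ((w k + sgn a * u k) / 2) * ((w k + sgn a * u k) / 2) ≤ 1 := by
  calc ∑ k, ((w k + sgn a * u k) / 2) * ((w k + sgn a * u k) / 2)
      ≤ ∑ k, (w k * w k + u k * u k) / 2 := by
        refine Finset.sum_le_sum fun k _ => ?_
        have h : (sgn a * u k) * (sgn a * u k) = u k * u k := by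
          rw [mul_mul_mul_comm, sgn_mul_self, one_mul]
        nlinarith [sq_nonneg (w k - sgn a * u k)]
    _ = 1 := by
        rw [← Finset.sum_div, Finset.sum_add_distrib, hw, hu]
        norm_num

theorem sum_midpoint_mul_midpoint {κ : Type*} [Fintype κ] {w : κ → ℝ}
    (hw : ∑ k, w k * w k = 1) (u v : κ → ℝ) (α β : ℝ) :
    ∑ k, ((w k + α * u k) / 2) * ((w k + β * v k) / 2) =
      (1 + α * ∑ k, w k * u k + β * ∑ k, w k * v k + α * β * ∑ k, u k * v k) / 4 := by
  rw [← hw, Finset.mul_sum, Finset.mul_sum, Finset.mul_sum, ← Finset.sum_add_distrib,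
    ← Finset.sum_add_distrib, ← Finset.sum_add_distrib, Finset.sum_div]
  exact Finset.sum_congr rfl fun k _ => by ring

/-- Inner products between two families of vectors in the unit ball are also inner products
between two families of unit vectors, in dimension the total number of vectors. -/
theorem exists_unit_vectors {P R κ : Type*} [Fintype P] [Fintype R] [Fintype κ] {N : ℕ}
    (hN : Fintype.card P + Fintype.card R = N) (l : P → κ → ℝ) (r : R → κ → ℝ)
    (hl : ∀ p, ∑ k, l p k * l p k ≤ 1) (hr : ∀ p, ∑ k, r p k * r p k ≤ 1) :
    ∃ (u : P → Fin N → ℝ) (v : R → Fin N → ℝ),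
      (∀ p, ∑ k, u p k * u p k = 1) ∧ (∀ p, ∑ k, v p k * v p k = 1) ∧
      ∀ p s, ∑ k, u p k * v s k = ∑ k, l p k * r s k := by
  let L : P → κ ⊕ Bool → ℝ := fun p =>
    Sum.elim (l p) fun c => if c then √(1 - ∑ k, l p k * l p k) else 0
  let M : R → κ ⊕ Bool → ℝ := fun p =>
    Sum.elim (r p) fun c => if c then 0 else √(1 - ∑ k, r p k * r p k)
  obtain ⟨g, hg⟩ := exists_same_gram (Fintype.card_sum.trans hN) (Sum.elim L M)
  refine ⟨fun p => g (.inl p), fun p => g (.inr p), fun p => ?_, fun p => ?_, fun p s => ?_⟩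
  · simp [hg, L, Real.mul_self_sqrt (sub_nonneg.mpr (hl p))]
  · simp [hg, M, Real.mul_self_sqrt (sub_nonneg.mpr (hr p))]
  · simp [hg, L, M]

/-- If `x ∈ E(∇K_{m,n})` then the correlation table
`q_{(a,i),(b,j)} = (1 + a·x_{XA_i} + b·x_{XB_j} + ab·x_{A_iB_j})/4`
belongs to `E(K_{2m,2n})`. -/
theorem table_mem_ellK2 (m n : ℕ)
    (x : (Fin m → ℝ) × (Fin n → ℝ) × (Fin m → Fin n → ℝ))
    (hx : x ∈ EllSusp m n)
    (q : (Bool × Fin m) → (Bool × Fin n) → ℝ)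
    (hq : ∀ a i b j, q (a, i) (b, j) =
      (1 + sgn a * x.1 i + sgn b * x.2.1 j + sgn a * sgn b * x.2.2 i j) / 4) :
    q ∈ EllK2 m n := by
  obtain ⟨w, u, v, hw, hu, hv, hxu, hxv, hxuv⟩ := hx
  obtain ⟨u', v', hu', hv', h⟩ := exists_unit_vectors (N := 2 * m + 2 * n) (by simp)
    (fun (p : Bool × Fin m) k => (w k + sgn p.1 * u p.2 k) / 2)
    (fun (p : Bool × Fin n) k => (w k + sgn p.1 * v p.2 k) / 2)
    (fun p => sum_midpoint_sq_le_one hw (hu p.2) p.1)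
    (fun p => sum_midpoint_sq_le_one hw (hv p.2) p.1)
  refine ⟨u', v', hu', hv', ?_⟩
  rintro ⟨a, i⟩ ⟨b, j⟩
  rw [h, hq, hxu, hxv, hxuv, sum_midpoint_mul_midpoint hw]
end

section
/- Let (d_A, d_B, ρ, A_1,…,A_m, B_1,…,B_n) be a finite-dimensional quantum realization and define q ∈ ℝ^{(2m)×(2n)} by q_{(a,i),(b,j)} = tr(ρ ((I + aA_i)/2 ⊗ (I + bB_j)/2)) for a,b ∈ {−1,+1}, where ⊗ denotes the Kronecker product. Then q belongs to the elliptope E(K_{2m,2n}), and moreover q satisfies the no-signaling polytope conditions: q_{(a,i),(b,j)} ≥ 0, Σ_{a,b∈{±1}} q_{(a,i),(b,j)} = 1 for all i,j, Σ_{b∈{±1}} q_{(a,i),(b,j)} is independent of j, and Σ_{a∈{±1}} q_{(a,i),(b,j)} is independent of i. -/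
open Finset Matrix Kronecker ComplexOrder

open scoped MatrixOrder in
theorem Matrix.PosSemidef.trace_mul_nonneg {ι : Type*} [Fintype ι] {M N : Matrix ι ι ℂ}
    (hM : M.PosSemidef) (hN : N.PosSemidef) : 0 ≤ (M * N).trace := by
  classical
  obtain ⟨C, rfl⟩ := CStarAlgebra.nonneg_iff_eq_star_mul_self.mp hM.nonneg
  rw [star_eq_conjTranspose, Matrix.mul_assoc, trace_mul_comm]
  exact (hN.mul_mul_conjTranspose_same C).trace_nonneg

open scoped MatrixOrder in
/-- A real positive semidefinite matrix is a Gram matrix. -/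
theorem Matrix.PosSemidef.exists_gram {ι : Type*} [Fintype ι] {G : Matrix ι ι ℝ}
    (hG : G.PosSemidef) : ∃ C : Matrix ι ι ℝ, ∀ s t, G s t = ∑ k, C k s * C k t := by
  classical
  obtain ⟨C, rfl⟩ := CStarAlgebra.nonneg_iff_eq_star_mul_self.mp hG.nonneg
  exact ⟨C, fun s t => by simp [star_eq_conjTranspose, mul_apply]⟩

theorem Matrix.posSemidef_one_sub_mul_self {ι : Type*} [Fintype ι] [DecidableEq ι]
    {X : Matrix ι ι ℂ} (h : X.PosSemidef) (h' : (1 - X).PosSemidef) :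
    (1 - X * X).PosSemidef := by
  have e : 1 - X * X = (1 - X) + (X * (1 - X) * Xᴴ + (1 - X) * X * (1 - X)ᴴ) := by
    rw [h'.isHermitian.eq, h.isHermitian.eq]
    noncomm_ring
  rw [e]
  exact h'.add ((h'.mul_mul_conjTranspose_same X).add (h.mul_mul_conjTranspose_same (1 - X)))

/-- The real correlations of distinct contractive effects in a state are inner products of unit
vectors. -/
theorem exists_unit_vectors_of_effects {ι κ : Type*} [Fintype ι] [Fintype κ]
    [DecidableEq κ] {ρ : Matrix κ κ ℂ} (hρ : ρ.PosSemidef)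
    (hρtr : ρ.trace = 1) (X : ι → Matrix κ κ ℂ) (hX : ∀ s, (X s).PosSemidef)
    (hX' : ∀ s, (1 - X s).PosSemidef) :
    ∃ C : Matrix ι ι ℝ, (∀ s, ∑ k, C k s * C k s = 1) ∧
      ∀ s t, s ≠ t → ∑ k, C k s * C k t = (ρ * (X s * X t)).trace.re := by
  classical
  let G₀ : Matrix ι ι ℝ := of fun s t => (ρ * (X s * X t)).trace.re
  have hG₀ : G₀.PosSemidef := by
    refine .of_dotProduct_mulVec_nonneg ?_ fun x => ?_
    · ext s t
      simp only [conjTranspose_apply, G₀, of_apply, star_trivial]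
      rw [← Complex.conj_re, starRingEnd_apply, ← trace_conjTranspose, conjTranspose_mul,
        conjTranspose_mul, (hX s).isHermitian.eq, (hX t).isHermitian.eq, hρ.isHermitian.eq,
        trace_mul_comm]
    · have hY : (∑ s, (x s : ℂ) • X s)ᴴ = ∑ s, (x s : ℂ) • X s := by
        simp [conjTranspose_sum, (hX _).isHermitian.eq]
      have h := hρ.trace_mul_nonneg
        (posSemidef_conjTranspose_mul_self (∑ s, (x s : ℂ) • X s))
      rw [hY] at h
      refine (Complex.le_def.1 h).1.trans_eq (Eq.symm ?_)
      simp only [dotProduct, mulVec, G₀, of_apply, Finset.mul_sum, Finset.sum_mul, trace_sum,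
        Complex.re_sum, star_trivial]
      rw [Finset.sum_comm]
      refine Finset.sum_congr rfl fun s _ => Finset.sum_congr rfl fun t _ => ?_
      simp only [Matrix.smul_mul, Matrix.mul_smul, trace_smul, smul_eq_mul, Complex.re_ofReal_mul]
      ring
  have hd : 0 ≤ fun s => 1 - G₀ s s := fun s => by
    have h := (Complex.le_def.1
      (hρ.trace_mul_nonneg (posSemidef_one_sub_mul_self (hX s) (hX' s)))).1
    simpa [Matrix.mul_sub, hρtr, G₀] using h
  obtain ⟨C, hC⟩ := (hG₀.add (.diagonal hd)).exists_gram
  refine ⟨C, fun s => ?_, fun s t hst => ?_⟩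
  · rw [← hC]
    simp
  · rw [← hC]
    simp [hst, G₀]

/-- The effect `(1 + a H) / 2` of outcome `a` of a `±1`-valued observable `H`. -/
noncomputable def outcomeEffect {d : ℕ} (H : Matrix (Fin d) (Fin d) ℂ) (a : Bool) :
    Matrix (Fin d) (Fin d) ℂ :=
  (2 : ℂ)⁻¹ • (1 + ((sgn a : ℝ) : ℂ) • H)

theorem posSemidef_outcomeEffect {d : ℕ} {H : Matrix (Fin d) (Fin d) ℂ}
    (h₁ : (1 - H).PosSemidef) (h₂ : (1 + H).PosSemidef) (a : Bool) :
    (outcomeEffect H a).PosSemidef := by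
  have h : (0 : ℂ) ≤ 2⁻¹ := by positivity
  cases a
  · simpa [outcomeEffect, sgn, ← sub_eq_add_neg] using h₁.smul h
  · simpa [outcomeEffect, sgn] using h₂.smul h

theorem outcomeEffect_true_add_false {d : ℕ} (H : Matrix (Fin d) (Fin d) ℂ) :
    outcomeEffect H true + outcomeEffect H false = 1 := by
  rw [outcomeEffect, outcomeEffect, ← smul_add]
  have e : (1 + ((sgn true : ℝ) : ℂ) • H) + (1 + ((sgn false : ℝ) : ℂ) • H) =
      (2 : ℂ) • (1 : Matrix (Fin d) (Fin d) ℂ) := by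
    simp only [sgn, two_smul, if_true, Bool.false_eq_true, if_false, Complex.ofReal_one,
      Complex.ofReal_neg, one_smul, neg_smul]
    abel
  rw [e, smul_smul]
  simp

theorem one_sub_outcomeEffect {d : ℕ} (H : Matrix (Fin d) (Fin d) ℂ) (a : Bool) :
    1 - outcomeEffect H a = outcomeEffect H (!a) := by
  rw [← outcomeEffect_true_add_false H]
  cases a <;> simp

/-- The probability table of a finite-dimensional quantum realization,
`q_{(a,i),(b,j)} = tr (ρ ((I + aA_i)/2 ⊗ (I + bB_j)/2))`, belongs to the
elliptope `E(K_{2m,2n})` and satisfies nonnegativity, normalization and the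
no-signaling conditions. -/
theorem quantum_table_mem_ellK2_and_nosignaling (m n : ℕ) (dA dB : ℕ)
    (hdA : 0 < dA) (hdB : 0 < dB)
    (ρ : Matrix (Fin dA × Fin dB) (Fin dA × Fin dB) ℂ)
    (A : Fin m → Matrix (Fin dA) (Fin dA) ℂ)
    (B : Fin n → Matrix (Fin dB) (Fin dB) ℂ)
    (hρ : ρ.PosSemidef) (hρtr : ρ.trace = 1)
    (hA : ∀ i, (A i).IsHermitian) (hB : ∀ j, (B j).IsHermitian)
    (hA1 : ∀ i, (1 - A i).PosSemidef) (hA2 : ∀ i, (1 + A i).PosSemidef)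
    (hB1 : ∀ j, (1 - B j).PosSemidef) (hB2 : ∀ j, (1 + B j).PosSemidef)
    (q : (Bool × Fin m) → (Bool × Fin n) → ℝ)
    (hq : ∀ a i b j, (q (a, i) (b, j) : ℂ) =
      (ρ * (((2 : ℂ)⁻¹ • (1 + ((sgn a : ℝ) : ℂ) • A i)) ⊗ₖ
            ((2 : ℂ)⁻¹ • (1 + ((sgn b : ℝ) : ℂ) • B j)))).trace) :
    q ∈ EllK2 m n ∧
    (∀ a i b j, 0 ≤ q (a, i) (b, j)) ∧
    (∀ i j, ∑ a, ∑ b, q (a, i) (b, j) = 1) ∧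
    (∀ a i j j', ∑ b, q (a, i) (b, j) = ∑ b, q (a, i) (b, j')) ∧
    (∀ b j i i', ∑ a, q (a, i) (b, j) = ∑ a, q (a, i') (b, j)) := by
  have hE a i := posSemidef_outcomeEffect (hA1 i) (hA2 i) a
  have hF b j := posSemidef_outcomeEffect (hB1 j) (hB2 j) b
  replace hq : ∀ a i b j, (q (a, i) (b, j) : ℂ) =
      (ρ * (outcomeEffect (A i) a ⊗ₖ outcomeEffect (B j) b)).trace := hq
  have sum_right : ∀ a i j, ((∑ b, q (a, i) (b, j) : ℝ) : ℂ) =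
      (ρ * (outcomeEffect (A i) a ⊗ₖ 1)).trace := fun a i j => by
    rw [← outcomeEffect_true_add_false (B j)]
    simp [hq, kronecker_add, Matrix.mul_add]
  have sum_left : ∀ b j i, ((∑ a, q (a, i) (b, j) : ℝ) : ℂ) =
      (ρ * (1 ⊗ₖ outcomeEffect (B j) b)).trace := fun b j i => by
    rw [← outcomeEffect_true_add_false (A i)]
    simp [hq, add_kronecker, Matrix.mul_add]
  refine ⟨?_, fun a i b j => ?_, fun i j => ?_, fun a i j j' => ?_, fun b j i i' => ?_⟩
  · let X : (Bool × Fin m) ⊕ (Bool × Fin n) → Matrix (Fin dA × Fin dB) (Fin dA × Fin dB) ℂ :=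
      Sum.elim (fun p => outcomeEffect (A p.2) p.1 ⊗ₖ 1) (fun r => 1 ⊗ₖ outcomeEffect (B r.2) r.1)
    have hX : ∀ s, (X s).PosSemidef := by
      rintro (p | r)
      · exact (hE _ _).kronecker .one
      · exact PosSemidef.one.kronecker (hF _ _)
    have hX' : ∀ s, (1 - X s).PosSemidef := by
      rintro (⟨a, i⟩ | ⟨b, j⟩)
      · have e : 1 - X (.inl (a, i)) = outcomeEffect (A i) (!a) ⊗ₖ 1 := by
          rw [← one_sub_outcomeEffect, sub_eq_iff_eq_add, show X (.inl (a, i)) = outcomeEffect (A i) a ⊗ₖ 1 from rfl,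
            ← add_kronecker,
            sub_add_cancel, one_kronecker_one]
        rw [e]
        exact (hE _ _).kronecker .one
      · have e : 1 - X (.inr (b, j)) = 1 ⊗ₖ outcomeEffect (B j) (!b) := by
          rw [← one_sub_outcomeEffect, sub_eq_iff_eq_add, show X (.inr (b, j)) = 1 ⊗ₖ outcomeEffect (B j) b from rfl,
            ← kronecker_add,
            sub_add_cancel, one_kronecker_one]
        rw [e]
        exact PosSemidef.one.kronecker (hF _ _)
    obtain ⟨C, hC, hC'⟩ := exists_unit_vectors_of_effects hρ hρtr X hX hX'
    let e : Fin (2 * m + 2 * n) ≃ (Bool × Fin m) ⊕ (Bool × Fin n) :=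
      (Fintype.equivFinOfCardEq (by simp)).symm
    refine ⟨fun p k => C (e k) (.inl p), fun r k => C (e k) (.inr r), fun p => ?_, fun r => ?_,
      fun p r => ?_⟩
    · rw [e.sum_comp fun k => C k (.inl p) * C k (.inl p), hC]
    · rw [e.sum_comp fun k => C k (.inr r) * C k (.inr r), hC]
    · rw [e.sum_comp fun k => C k (.inl p) * C k (.inr r), hC' _ _ Sum.inl_ne_inr]
      simp only [X, Sum.elim_inl, Sum.elim_inr, ← mul_kronecker_mul, Matrix.mul_one,
        Matrix.one_mul]
      rw [← hq, Complex.ofReal_re]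
  · have h := hρ.trace_mul_nonneg ((hE a i).kronecker (hF b j))
    rw [← hq] at h
    exact_mod_cast h
  · apply Complex.ofReal_injective
    rw [Complex.ofReal_sum]
    simp only [sum_right]
    rw [Fintype.sum_bool, ← trace_add, ← Matrix.mul_add, ← add_kronecker,
      outcomeEffect_true_add_false, one_kronecker_one, Matrix.mul_one, hρtr, Complex.ofReal_one]
  · exact Complex.ofReal_injective ((sum_right a i j).trans (sum_right a i j').symm)
  · exact Complex.ofReal_injective ((sum_left b j i).trans (sum_left b j i').symm)
end

section
/- Let m, n ≥ 2, let i_1 ≠ i_2 be indices in {1,…,m} and j_1 ≠ j_2 indices in {1,…,n}. Then the CHSH inequality x_{i_1j_1} + x_{i_1j_2} + x_{i_2j_1} − x_{i_2j_2} ≤ 2 is facet-inducing for the cut polytope Cut(K_{m,n}). -/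
open Finset

/-- The cut vectors of the complete bipartite graph `K_{m,n}`. -/
def cutVectorsK (m n : ℕ) : Set (Fin m → Fin n → ℝ) :=
  {x | ∃ (a : Fin m → ℝ) (b : Fin n → ℝ),
    (∀ i, a i = 1 ∨ a i = -1) ∧ (∀ j, b j = 1 ∨ b j = -1) ∧
    x = fun i j => a i * b j}

/-- The inequality `⟨c, x⟩ ≤ c₀` is facet-inducing for `Cut(K_{m,n})`:
`c ≠ 0`, the inequality is valid on the cut polytope, and the set of cut
vectors attaining equality has affine span of dimension `mn − 1`. -/
def IsFacet (m n : ℕ) (c : Fin m → Fin n → ℝ) (c₀ : ℝ) : Prop :=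
  c ≠ 0 ∧
  (∀ x ∈ convexHull ℝ (cutVectorsK m n), ∑ i, ∑ j, c i j * x i j ≤ c₀) ∧
  Module.finrank ℝ
    (affineSpan ℝ {x ∈ cutVectorsK m n | ∑ i, ∑ j, c i j * x i j = c₀}).direction
    = m * n - 1

/-- A linear form vanishing on all sign vectors is zero. -/
theorem linearMap_eq_zero_of_sign {n : ℕ} (g : (Fin n → ℝ) →ₗ[ℝ] ℝ)
    (hg : ∀ b : Fin n → ℝ, (∀ j, b j = 1 ∨ b j = -1) → g b = 0) : g = 0 := by
  refine LinearMap.pi_ext' fun j => LinearMap.ext_ring ?_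
  have h1 := hg (fun _ => 1) (fun _ => Or.inl rfl)
  have h2 := hg (fun k => if k = j then -1 else 1) (fun k => by by_cases h : k = j <;> simp [h])
  have h3 : (Pi.single j 1 : Fin n → ℝ) =
      (1 / 2 : ℝ) • ((fun _ => 1) - fun k => if k = j then -1 else 1) := by
    ext k
    by_cases h : k = j
    · subst h; norm_num
    · simp [h]
  simp [h3, h1, h2]

/-- The CHSH expression of the cut vector given by `a` and `b`. -/
def chshValue {m n : ℕ} (i₁ i₂ : Fin m) (j₁ j₂ : Fin n) (a : Fin m → ℝ) (b : Fin n → ℝ) : ℝ :=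
  a i₁ * b j₁ + a i₁ * b j₂ + a i₂ * b j₁ - a i₂ * b j₂

/-- `B` takes the same value on all pairs of sign vectors for which CHSH is tight. -/
def ConstOnTight {m n : ℕ} (i₁ i₂ : Fin m) (j₁ j₂ : Fin n)
    (B : (Fin m → ℝ) →ₗ[ℝ] (Fin n → ℝ) →ₗ[ℝ] ℝ) : Prop :=
  ∀ a b a' b', (∀ i, a i = 1 ∨ a i = -1) → (∀ j, b j = 1 ∨ b j = -1) →
    (∀ i, a' i = 1 ∨ a' i = -1) → (∀ j, b' j = 1 ∨ b' j = -1) →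
    chshValue i₁ i₂ j₁ j₂ a b = 2 → chshValue i₁ i₂ j₁ j₂ a' b' = 2 → B a b = B a' b'

theorem ConstOnTight.flip {m n : ℕ} {i₁ i₂ : Fin m} {j₁ j₂ : Fin n}
    {B : (Fin m → ℝ) →ₗ[ℝ] (Fin n → ℝ) →ₗ[ℝ] ℝ} (hB : ConstOnTight i₁ i₂ j₁ j₂ B) :
    ConstOnTight j₁ j₂ i₁ i₂ B.flip := by
  intro a b a' b' ha hb ha' hb' h h'
  refine hB b a b' a' hb ha hb' ha' ?_ ?_
  · rw [← h]; unfold chshValue; ring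
  · rw [← h']; unfold chshValue; ring

theorem ConstOnTight.single_eq_zero {m n : ℕ} {i₁ i₂ : Fin m} {j₁ j₂ : Fin n}
    {B : (Fin m → ℝ) →ₗ[ℝ] (Fin n → ℝ) →ₗ[ℝ] ℝ} (hB : ConstOnTight i₁ i₂ j₁ j₂ B)
    {i : Fin m} (h₁ : i ≠ i₁) (h₂ : i ≠ i₂) : B (Pi.single i 1) = 0 := by
  refine linearMap_eq_zero_of_sign _ fun b hb => ?_
  have hval : ∀ s : ℝ, chshValue i₁ i₂ j₁ j₂ (fun k => if k = i then s else b j₁) b = 2 := by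
    intro s
    simp only [chshValue, h₁.symm, h₂.symm, if_false]
    rcases hb j₁ with h | h <;> rw [h] <;> ring
  have hsign : ∀ s : ℝ, (s = 1 ∨ s = -1) → ∀ k, (if k = i then s else b j₁) = 1 ∨
      (if k = i then s else b j₁) = -1 := by
    intro s hs k
    split_ifs
    exacts [hs, hb j₁]
  have key := hB _ b _ b (hsign 1 (Or.inl rfl)) hb (hsign (-1) (Or.inr rfl)) hb (hval 1) (hval (-1))
  have h3 : (Pi.single i 1 : Fin m → ℝ) = (1 / 2 : ℝ) •
      ((fun k => if k = i then 1 else b j₁) - fun k => if k = i then -1 else b j₁) := by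
    ext k
    by_cases h : k = i
    · subst h; norm_num
    · simp [h]
  simp [h3, key]

theorem ConstOnTight.apply_eq {m n : ℕ} {i₁ i₂ : Fin m} {j₁ j₂ : Fin n} (hi : i₁ ≠ i₂)
    {B : (Fin m → ℝ) →ₗ[ℝ] (Fin n → ℝ) →ₗ[ℝ] ℝ} (hB : ConstOnTight i₁ i₂ j₁ j₂ B)
    (a : Fin m → ℝ) (b : Fin n → ℝ) :
    B a b = a i₁ * B (Pi.single i₁ 1) b + a i₂ * B (Pi.single i₂ 1) b := by
  have h : B a = ∑ i, a i • B (Pi.single i 1) := by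
    conv_lhs => rw [pi_eq_sum_univ' a]
    simp only [map_sum, map_smul]
  rw [h, ← Finset.sum_subset (Finset.subset_univ {i₁, i₂}), Finset.sum_pair hi]
  · simp
  · intro i _ hi'
    simp only [Finset.mem_insert, Finset.mem_singleton, not_or] at hi'
    rw [hB.single_eq_zero hi'.1 hi'.2, smul_zero]

theorem ConstOnTight.exists_eq_mul_chshValue {m n : ℕ} {i₁ i₂ : Fin m} {j₁ j₂ : Fin n}
    (hi : i₁ ≠ i₂) (hj : j₁ ≠ j₂)
    {B : (Fin m → ℝ) →ₗ[ℝ] (Fin n → ℝ) →ₗ[ℝ] ℝ} (hB : ConstOnTight i₁ i₂ j₁ j₂ B) :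
    ∃ r : ℝ, ∀ a b, B a b = r * chshValue i₁ i₂ j₁ j₂ a b := by
  obtain ⟨d, hd⟩ : ∃ d : Fin m → Fin n → ℝ, ∀ a b, B a b =
      a i₁ * (b j₁ * d i₁ j₁ + b j₂ * d i₁ j₂) + a i₂ * (b j₁ * d i₂ j₁ + b j₂ * d i₂ j₂) := by
    refine ⟨fun i j => B (Pi.single i 1) (Pi.single j 1), fun a b => ?_⟩
    have hf := fun c => hB.flip.apply_eq hj b c
    simp only [LinearMap.flip_apply] at hf
    rw [hB.apply_eq hi a b, hf, hf]
  have key : ∀ s t : ℝ, (s = 1 ∨ s = -1) → (t = 1 ∨ t = -1) → ∀ u : ℝ, (u = 1 ∨ u = -1) →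
      s + s * u + t - t * u = 2 →
      s * (d i₁ j₁ + u * d i₁ j₂) + t * (d i₂ j₁ + u * d i₂ j₂) =
        d i₁ j₁ + d i₁ j₂ + (d i₂ j₁ + d i₂ j₂) := by
    intro s t hs ht u hu h
    have := hB (fun i => if i = i₁ then s else t) (fun j => if j = j₁ then 1 else u)
      (fun _ => 1) (fun _ => 1) (fun i => by split_ifs <;> assumption)
      (fun j => by split_ifs; exacts [Or.inl rfl, hu]) (fun _ => Or.inl rfl)
      (fun _ => Or.inl rfl) (by simp [chshValue, hi.symm, hj.symm, h])
      (by norm_num [chshValue])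
    rw [hd, hd] at this
    simpa [hi.symm, hj.symm] using this
  have k1 := key 1 (-1) (by simp) (by simp) 1 (by simp) (by norm_num)
  have k2 := key 1 1 (by simp) (by simp) (-1) (by simp) (by norm_num)
  have k3 := key (-1) 1 (by simp) (by simp) (-1) (by simp) (by norm_num)
  have e1 : d i₁ j₂ = d i₁ j₁ := by linarith
  have e2 : d i₂ j₁ = d i₁ j₁ := by linarith
  have e3 : d i₂ j₂ = -d i₁ j₁ := by linarith
  refine ⟨d i₁ j₁, fun a b => ?_⟩
  rw [hd, e1, e2, e3]
  unfold chshValue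
  ring

/-- The outer product of two vectors, as a bilinear map. -/
def outerProduct (m n : ℕ) :
    (Fin m → ℝ) →ₗ[ℝ] (Fin n → ℝ) →ₗ[ℝ] (Fin m → Fin n → ℝ) :=
  LinearMap.mk₂ ℝ (fun a b i j => a i * b j)
    (fun a a' b => by ext; simp [add_mul]) (fun r a b => by ext; simp [mul_assoc])
    (fun a b b' => by ext; simp [mul_add]) (fun r a b => by ext; simp [mul_left_comm])

/-- Linear forms on `ℝ^{m×n}` agreeing on outer products are equal. -/
theorem linearMap_ext_outerProduct {m n : ℕ} {f g : (Fin m → Fin n → ℝ) →ₗ[ℝ] ℝ}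
    (h : ∀ a b, f (outerProduct m n a b) = g (outerProduct m n a b)) : f = g := by
  refine LinearMap.pi_ext' fun i => LinearMap.pi_ext' fun j => LinearMap.ext_ring ?_
  have hs : outerProduct m n (Pi.single i 1) (Pi.single j 1) = Pi.single i (Pi.single j 1) := by
    ext k l
    by_cases hk : k = i
    · subst hk; simp [outerProduct]
    · simp [outerProduct, hk]
  simpa [hs] using h (Pi.single i 1) (Pi.single j 1)

/-- The CHSH expression as a linear form. -/
def chshForm {m n : ℕ} (i₁ i₂ : Fin m) (j₁ j₂ : Fin n) : (Fin m → Fin n → ℝ) →ₗ[ℝ] ℝ where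
  toFun x := x i₁ j₁ + x i₁ j₂ + x i₂ j₁ - x i₂ j₂
  map_add' x y := by simp only [Pi.add_apply]; ring
  map_smul' r x := by simp only [Pi.smul_apply, smul_eq_mul, RingHom.id_apply]; ring

theorem sum_chsh_mul {m n : ℕ} (i₁ i₂ : Fin m) (j₁ j₂ : Fin n) (x : Fin m → Fin n → ℝ) :
    ∑ i, ∑ j, ((if i = i₁ ∧ j = j₁ then 1 else 0) + (if i = i₁ ∧ j = j₂ then 1 else 0) +
        (if i = i₂ ∧ j = j₁ then 1 else 0) + (if i = i₂ ∧ j = j₂ then -1 else 0)) * x i j =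
      chshForm i₁ i₂ j₁ j₂ x := by
  simp [chshForm, add_mul, Finset.sum_add_distrib, ite_and, sub_eq_add_neg]

theorem chshForm_ne_zero {m n : ℕ} {i₁ i₂ : Fin m} {j₁ j₂ : Fin n} (hi : i₁ ≠ i₂) :
    chshForm i₁ i₂ j₁ j₂ ≠ 0 := by
  intro h
  have := LinearMap.congr_fun h (fun i _ => if i = i₁ then 1 else 0)
  norm_num [chshForm, hi.symm] at this

theorem chshForm_le_two {m n : ℕ} (i₁ i₂ : Fin m) (j₁ j₂ : Fin n) {x : Fin m → Fin n → ℝ}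
    (hx : x ∈ cutVectorsK m n) : chshForm i₁ i₂ j₁ j₂ x ≤ 2 := by
  obtain ⟨a, b, ha, hb, rfl⟩ := hx
  simp only [chshForm, LinearMap.coe_mk, AddHom.coe_mk]
  rcases ha i₁ with h1 | h1 <;> rcases ha i₂ with h2 | h2 <;> rcases hb j₁ with h3 | h3 <;>
    rcases hb j₂ with h4 | h4 <;> norm_num [h1, h2, h3, h4]

theorem direction_affineSpan_chsh {m n : ℕ} {i₁ i₂ : Fin m} {j₁ j₂ : Fin n}
    (hi : i₁ ≠ i₂) (hj : j₁ ≠ j₂) :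
    (affineSpan ℝ {x ∈ cutVectorsK m n | chshForm i₁ i₂ j₁ j₂ x = 2}).direction =
      LinearMap.ker (chshForm i₁ i₂ j₁ j₂) := by
  rw [direction_affineSpan]
  apply le_antisymm
  · rw [vectorSpan_def, Submodule.span_le]
    rintro _ ⟨x, hx, y, hy, rfl⟩
    simp [hx.2, hy.2]
  · intro x hx
    by_contra hxD
    obtain ⟨f, hfx, hf⟩ := Submodule.exists_le_ker_of_notMem hxD
    have hB : ConstOnTight i₁ i₂ j₁ j₂ ((outerProduct m n).compr₂ f) := by
      intro a b a' b' ha hb ha' hb' h h'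
      have := hf (vsub_mem_vectorSpan ℝ
        (s := {x ∈ cutVectorsK m n | chshForm i₁ i₂ j₁ j₂ x = 2})
        (p₁ := outerProduct m n a b) (p₂ := outerProduct m n a' b')
        ⟨⟨a, b, ha, hb, rfl⟩, h⟩ ⟨⟨a', b', ha', hb', rfl⟩, h'⟩)
      rw [LinearMap.mem_ker, vsub_eq_sub, map_sub] at this
      exact sub_eq_zero.1 this
    obtain ⟨r, hr⟩ := hB.exists_eq_mul_chshValue hi hj
    have hfr : f = r • chshForm i₁ i₂ j₁ j₂ := linearMap_ext_outerProduct hr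
    apply hfx
    rw [hfr, LinearMap.smul_apply, LinearMap.mem_ker.1 hx, smul_zero]

/-- The CHSH inequality
`x_{i₁j₁} + x_{i₁j₂} + x_{i₂j₁} − x_{i₂j₂} ≤ 2` is facet-inducing for
`Cut(K_{m,n})`. -/
theorem chsh_isFacet (m n : ℕ) (hm : 2 ≤ m) (hn : 2 ≤ n)
    (i₁ i₂ : Fin m) (j₁ j₂ : Fin n) (hi : i₁ ≠ i₂) (hj : j₁ ≠ j₂) :
    IsFacet m n
      (fun i j =>
        (if i = i₁ ∧ j = j₁ then 1 else 0) + (if i = i₁ ∧ j = j₂ then 1 else 0) +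
        (if i = i₂ ∧ j = j₁ then 1 else 0) + (if i = i₂ ∧ j = j₂ then -1 else 0))
      2 := by
  refine ⟨fun h => ?_, fun x hx => ?_, ?_⟩
  · have := congrFun (congrFun h i₁) j₁
    norm_num [hi, hj] at this
  · rw [sum_chsh_mul]
    exact convexHull_min (fun y hy => chshForm_le_two i₁ i₂ j₁ j₂ hy)
      (convex_halfSpace_le (chshForm i₁ i₂ j₁ j₂).isLinear 2) hx
  · have hface := direction_affineSpan_chsh hi hj
    simp only [← sum_chsh_mul] at hface
    rw [hface]
    have h := Module.Dual.finrank_ker_add_one_of_ne_zero (chshForm_ne_zero (j₁ := j₁) (j₂ := j₂) hi)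
    have hdim : Module.finrank ℝ (Fin m → Fin n → ℝ) = m * n := by
      simp [Module.finrank_pi_fintype]
    rw [hdim] at h
    omega
end

section
/- For all positive integers m, n and any indices 1 ≤ i ≤ m, 1 ≤ j ≤ n, the trivial inequalities x_{ij} ≤ 1 and −x_{ij} ≤ 1 are facet-inducing for the cut polytope Cut(K_{m,n}). -/
open Finset

/-- A difference of two cut vectors on the face `x i₀ j₀ = s` lies in the direction of its
affine span. -/
lemma cut_sub_cut_mem_vectorSpan {m n : ℕ} {i₀ : Fin m} {j₀ : Fin n} {s : ℝ}
    {a a' : Fin m → ℝ} {b b' : Fin n → ℝ}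
    (ha : ∀ i, a i = 1 ∨ a i = -1) (ha' : ∀ i, a' i = 1 ∨ a' i = -1)
    (hb : ∀ j, b j = 1 ∨ b j = -1) (hb' : ∀ j, b' j = 1 ∨ b' j = -1)
    (h : a i₀ * b j₀ = s) (h' : a' i₀ * b' j₀ = s) :
    ((fun i j => a i * b j) - fun i j => a' i * b' j) ∈
      vectorSpan ℝ {x ∈ cutVectorsK m n | x i₀ j₀ = s} :=
  vsub_mem_vectorSpan ℝ ⟨⟨a, b, ha, hb, rfl⟩, h⟩ ⟨⟨a', b', ha', hb', rfl⟩, h'⟩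

/-- Every coordinate vector other than the one at `(i₀, j₀)` is a direction of the face
`x i₀ j₀ = s`. -/
lemma single_mem_vectorSpan_face {m n : ℕ} {i₀ : Fin m} {j₀ : Fin n} {s : ℝ}
    (hs : s = 1 ∨ s = -1) {k : Fin m} {l : Fin n} (hkl : ¬ (k = i₀ ∧ l = j₀)) :
    (fun i j => if i = k ∧ j = l then (1 : ℝ) else 0) ∈
      vectorSpan ℝ {x ∈ cutVectorsK m n | x i₀ j₀ = s} := by
  have key : ∀ (a a' : Fin m → ℝ) (b b' : Fin n → ℝ),
      (∀ i, a i = 1 ∨ a i = -1) → (∀ i, a' i = 1 ∨ a' i = -1) →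
      (∀ j, b j = 1 ∨ b j = -1) → (∀ j, b' j = 1 ∨ b' j = -1) →
      a i₀ * b j₀ = s → a' i₀ * b' j₀ = s → _ :=
    fun a a' b b' ha ha' hb hb' h h' =>
      cut_sub_cut_mem_vectorSpan (i₀ := i₀) (j₀ := j₀) ha ha' hb hb' h h'
  by_cases hk : k = i₀
  · have hl : l ≠ j₀ := fun hl => hkl ⟨hk, hl⟩
    subst hk
    have h₁ := key (fun i => if i = k then s else 1) (fun i => if i = k then s else 1)
      (fun _ => 1) (fun j => if j = l then -1 else 1)
      (by grind) (by grind) (by grind) (by grind) (by grind) (by grind)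
    have h₂ := key (fun i => if i = k then s else -1) (fun i => if i = k then s else -1)
      (fun _ => 1) (fun j => if j = l then -1 else 1)
      (by grind) (by grind) (by grind) (by grind) (by grind) (by grind)
    convert Submodule.smul_mem _ (s / 4) (Submodule.add_mem _ h₁ h₂) using 1
    ext i j
    simp only [Pi.smul_apply, Pi.add_apply, Pi.sub_apply, smul_eq_mul]
    rcases hs with rfl | rfl <;> by_cases hi : i = k <;> by_cases hj : j = l <;>
      simp [hi, hj] <;> norm_num
  · by_cases hl : l = j₀
    · subst hl
      have h₁ := key (fun i => if i = i₀ then s else 1)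
        (fun i => if i = i₀ then s else if i = k then -1 else 1)
        (fun _ => 1) (fun _ => 1)
        (by grind) (by grind) (by grind) (by grind) (by grind) (by grind)
      have h₂ := key (fun i => if i = i₀ then s else 1)
        (fun i => if i = i₀ then s else if i = k then -1 else 1)
        (fun j => if j = l then 1 else -1) (fun j => if j = l then 1 else -1)
        (by grind) (by grind) (by grind) (by grind) (by grind) (by grind)
      convert Submodule.smul_mem _ (1 / 4 : ℝ) (Submodule.add_mem _ h₁ h₂) using 1
      ext i j
      simp only [Pi.smul_apply, Pi.add_apply, Pi.sub_apply, smul_eq_mul]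
      grind
    · have h₁ := key (fun i => if i = i₀ then s else 1)
        (fun i => if i = i₀ then s else if i = k then -1 else 1)
        (fun _ => 1) (fun _ => 1)
        (by grind) (by grind) (by grind) (by grind) (by grind) (by grind)
      have h₂ := key (fun i => if i = i₀ then s else 1)
        (fun i => if i = i₀ then s else if i = k then -1 else 1)
        (fun j => if j = l then -1 else 1) (fun j => if j = l then -1 else 1)
        (by grind) (by grind) (by grind) (by grind) (by grind) (by grind)
      convert Submodule.smul_mem _ (1 / 4 : ℝ) (Submodule.sub_mem _ h₁ h₂) using 1
      ext i j
      simp only [Pi.smul_apply, Pi.sub_apply, smul_eq_mul]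
      grind

/-- The direction of the face `x i₀ j₀ = s` is the hyperplane `x i₀ j₀ = 0`. -/
lemma vectorSpan_face_eq_ker {m n : ℕ} (i₀ : Fin m) (j₀ : Fin n) {s : ℝ}
    (hs : s = 1 ∨ s = -1) :
    vectorSpan ℝ {x ∈ cutVectorsK m n | x i₀ j₀ = s} =
      LinearMap.ker ((LinearMap.proj j₀ : (Fin n → ℝ) →ₗ[ℝ] ℝ) ∘ₗ
        (LinearMap.proj i₀ : (Fin m → Fin n → ℝ) →ₗ[ℝ] (Fin n → ℝ))) := by
  apply le_antisymm
  · rw [vectorSpan_def, Submodule.span_le]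
    rintro _ ⟨x, hx, y, hy, rfl⟩
    simp [hx.2, hy.2]
  · intro x hx
    have hx₀ : x i₀ j₀ = 0 := by simpa using hx
    have hsum : x = ∑ k, ∑ l, x k l • fun i j => if i = k ∧ j = l then (1 : ℝ) else 0 := by
      ext i j
      simp [Finset.sum_apply, ite_and]
    rw [hsum]
    refine Submodule.sum_mem _ fun k _ => Submodule.sum_mem _ fun l _ => ?_
    by_cases hkl : k = i₀ ∧ l = j₀
    · rw [hkl.1, hkl.2, hx₀, zero_smul]
      exact Submodule.zero_mem _
    · exact Submodule.smul_mem _ _ (single_mem_vectorSpan_face hs hkl)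

/-- The face `x i₀ j₀ = s` has codimension one. -/
lemma finrank_vectorSpan_face {m n : ℕ} (i₀ : Fin m) (j₀ : Fin n) {s : ℝ}
    (hs : s = 1 ∨ s = -1) :
    Module.finrank ℝ (vectorSpan ℝ {x ∈ cutVectorsK m n | x i₀ j₀ = s}) = m * n - 1 := by
  rw [vectorSpan_face_eq_ker i₀ j₀ hs]
  set f := (LinearMap.proj j₀ : (Fin n → ℝ) →ₗ[ℝ] ℝ) ∘ₗ
    (LinearMap.proj i₀ : (Fin m → Fin n → ℝ) →ₗ[ℝ] (Fin n → ℝ)) with hf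
  have hsurj : Function.Surjective f := fun r => ⟨fun _ _ => r, by simp [hf]⟩
  have hrank := LinearMap.finrank_range_add_finrank_ker f
  rw [LinearMap.range_eq_top.2 hsurj, finrank_top, Module.finrank_self,
    Module.finrank_pi_fintype] at hrank
  simp only [Module.finrank_fin_fun, Finset.sum_const, Finset.card_univ, Fintype.card_fin,
    smul_eq_mul] at hrank
  omega

lemma isFacet_signed_coordinate {m n : ℕ} (i₀ : Fin m) (j₀ : Fin n) {s : ℝ}
    (hs : s = 1 ∨ s = -1) :
    IsFacet m n (fun i j => if i = i₀ ∧ j = j₀ then s else 0) 1 := by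
  have hsum : ∀ x : Fin m → Fin n → ℝ,
      ∑ i, ∑ j, (if i = i₀ ∧ j = j₀ then s else 0) * x i j = s * x i₀ j₀ := by
    intro x
    simp [ite_and, ite_mul]
  refine ⟨fun h => ?_, fun x hx => ?_, ?_⟩
  · have h₀ := congrFun (congrFun h i₀) j₀
    rcases hs with rfl | rfl <;> simp at h₀
  · rw [hsum]
    have hconv : Convex ℝ {x : Fin m → Fin n → ℝ | s * x i₀ j₀ ≤ 1} := by
      intro x hx y hy p q hp hq hpq
      simp only [Set.mem_ofPred_eq, Pi.add_apply, Pi.smul_apply, smul_eq_mul] at *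
      nlinarith [mul_le_mul_of_nonneg_left hx hp, mul_le_mul_of_nonneg_left hy hq]
    refine convexHull_min ?_ hconv hx
    rintro _ ⟨a, b, ha, hb, rfl⟩
    rcases hs with rfl | rfl <;> rcases ha i₀ with h | h <;> rcases hb j₀ with h' | h' <;>
      norm_num [h, h']
  · have hset : {x ∈ cutVectorsK m n |
        ∑ i, ∑ j, (if i = i₀ ∧ j = j₀ then s else 0) * x i j = 1} =
        {x ∈ cutVectorsK m n | x i₀ j₀ = s} := by
      ext x
      simp only [hsum, Set.mem_ofPred_eq]
      refine and_congr_right fun _ => ?_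
      rcases hs with rfl | rfl <;> constructor <;> intro h <;> linarith
    rw [hset, direction_affineSpan]
    exact finrank_vectorSpan_face i₀ j₀ hs

/-- The trivial inequalities `x_{ij} ≤ 1` and `−x_{ij} ≤ 1` are facet-inducing
for `Cut(K_{m,n})`. -/
theorem trivial_isFacet (m n : ℕ) (hm : 0 < m) (hn : 0 < n)
    (i₀ : Fin m) (j₀ : Fin n) :
    IsFacet m n (fun i j => if i = i₀ ∧ j = j₀ then 1 else 0) 1 ∧
    IsFacet m n (fun i j => if i = i₀ ∧ j = j₀ then -1 else 0) 1 :=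
  ⟨isFacet_signed_coordinate i₀ j₀ (Or.inl rfl), isFacet_signed_coordinate i₀ j₀ (Or.inr rfl)⟩
end

section
/- The inequality ⟨c, x⟩ ≤ 10 is facet-inducing for the cut polytope Cut(K_{4,4}), where the coefficient matrix c ∈ ℝ^{4×4} (rows indexed by A_1,…,A_4, columns by B_1,…,B_4) is given by rows (−2, 2, 1, 1), (1, 2, −2, −1), (1, 1, 2, −2), (2, 1, 1, 2). -/
open Finset

open Module

/-- The linear functional `x ↦ ⟨c, x⟩` on `m × n` arrays. -/
def arrayPairing {m n : ℕ} (c : Fin m → Fin n → ℝ) : Dual ℝ (Fin m → Fin n → ℝ) :=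
  ∑ i, ∑ j, c i j • (LinearMap.proj (φ := fun _ : Fin n => ℝ) j ∘ₗ LinearMap.proj i)

lemma arrayPairing_apply {m n : ℕ} (c x : Fin m → Fin n → ℝ) :
    arrayPairing c x = ∑ i, ∑ j, c i j * x i j := by
  simp [arrayPairing, LinearMap.sum_apply]

lemma arrayPairing_smul {m n : ℕ} (t : ℝ) (c : Fin m → Fin n → ℝ) :
    arrayPairing (t • c) = t • arrayPairing c := by
  simp [arrayPairing, Finset.smul_sum, mul_smul]

lemma exists_eq_arrayPairing {m n : ℕ} (f : Dual ℝ (Fin m → Fin n → ℝ)) :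
    ∃ g, f = arrayPairing g := by
  refine ⟨fun i j => f (Pi.single i (Pi.single j 1)), ?_⟩
  ext i j
  simp [arrayPairing_apply, Pi.single_apply, apply_ite, ite_apply]

/-- If the functionals constant on `S` are exactly the multiples of `φ ≠ 0`, then the affine span
of `S` is a hyperplane. -/
lemma finrank_direction_affineSpan_of_dual {V : Type*} [AddCommGroup V] [Module ℝ V]
    [FiniteDimensional ℝ V] {S : Set V} {φ : Dual ℝ V} (hφ : φ ≠ 0) {k : ℝ}
    (hS : ∀ x ∈ S, φ x = k)
    (h : ∀ f : Dual ℝ V, (∀ x ∈ S, ∀ y ∈ S, f x = f y) → ∃ t : ℝ, t • φ = f) :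
    finrank ℝ (affineSpan ℝ S).direction = finrank ℝ V - 1 := by
  have key : (vectorSpan ℝ S).dualAnnihilator = Submodule.span ℝ {φ} := by
    apply le_antisymm
    · intro f hf
      rw [Submodule.mem_dualAnnihilator] at hf
      refine Submodule.mem_span_singleton.2 (h f fun x hx y hy => ?_)
      simpa [sub_eq_zero] using hf _ (vsub_mem_vectorSpan ℝ hx hy)
    · rw [Submodule.span_singleton_le_iff_mem, Submodule.mem_dualAnnihilator]
      suffices vectorSpan ℝ S ≤ LinearMap.ker φ from fun w hw => this hw
      rw [vectorSpan_def, Submodule.span_le]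
      rintro _ ⟨x, hx, y, hy, rfl⟩
      simp [hS x hx, hS y hy]
  have hsum := Subspace.finrank_add_finrank_dualAnnihilator_eq (vectorSpan ℝ S)
  rw [key, finrank_span_singleton hφ] at hsum
  rw [direction_affineSpan]
  omega

/-- The coefficients of Gisin's first `(4,4)` correlation inequality. -/
abbrev gisin1 : Fin 4 → Fin 4 → ℝ :=
  ![![-2, 2, 1, 1], ![1, 2, -2, -1], ![1, 1, 2, -2], ![2, 1, 1, 2]]

lemma gisin1_le {a b : Fin 4 → ℝ} (ha : ∀ i, a i = 1 ∨ a i = -1)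
    (hb : ∀ j, b j = 1 ∨ b j = -1) : ∑ i, ∑ j, gisin1 i j * (a i * b j) ≤ 10 := by
  have hb' (j) : -1 ≤ b j ∧ b j ≤ 1 := by rcases hb j with h | h <;> norm_num [h]
  obtain ⟨_, _⟩ := hb' 0
  obtain ⟨_, _⟩ := hb' 1
  obtain ⟨_, _⟩ := hb' 2
  obtain ⟨_, _⟩ := hb' 3
  simp only [Fin.sum_univ_four, gisin1, Matrix.cons_val]
  rcases ha 0 with h0 | h0 <;> rcases ha 1 with h1 | h1 <;> rcases ha 2 with h2 | h2 <;>
    rcases ha 3 with h3 | h3 <;> rw [h0, h1, h2, h3] <;> linarith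

/-- An array pairing to the constant `t` with every cut vector on the face is a multiple of
`gisin1`. -/
lemma eq_smul_gisin1 {g : Fin 4 → Fin 4 → ℝ} {t : ℝ}
    (hg : ∀ a b : Fin 4 → ℝ, (∀ i, a i = 1 ∨ a i = -1) → (∀ j, b j = 1 ∨ b j = -1) →
      ∑ i, ∑ j, gisin1 i j * (a i * b j) = 10 → ∑ i, ∑ j, g i j * (a i * b j) = t) :
    g = (t / 10) • gisin1 := by
  have h0 := hg ![1, 1, 1, 1] ![1, 1, 1, 1] (by simp [Fin.forall_fin_succ])
    (by simp [Fin.forall_fin_succ]) (by norm_num [Fin.sum_univ_succ])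
  have h1 := hg ![1, 1, 1, 1] ![1, 1, 1, -1] (by simp [Fin.forall_fin_succ])
    (by simp [Fin.forall_fin_succ]) (by norm_num [Fin.sum_univ_succ])
  have h2 := hg ![1, 1, 1, -1] ![-1, 1, 1, -1] (by simp [Fin.forall_fin_succ])
    (by simp [Fin.forall_fin_succ]) (by norm_num [Fin.sum_univ_succ])
  have h3 := hg ![1, 1, 1, -1] ![-1, 1, -1, -1] (by simp [Fin.forall_fin_succ])
    (by simp [Fin.forall_fin_succ]) (by norm_num [Fin.sum_univ_succ])
  have h4 := hg ![1, 1, -1, 1] ![1, 1, -1, 1] (by simp [Fin.forall_fin_succ])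
    (by simp [Fin.forall_fin_succ]) (by norm_num [Fin.sum_univ_succ])
  have h5 := hg ![1, 1, -1, 1] ![-1, 1, -1, 1] (by simp [Fin.forall_fin_succ])
    (by simp [Fin.forall_fin_succ]) (by norm_num [Fin.sum_univ_succ])
  have h6 := hg ![1, 1, -1, -1] ![-1, 1, -1, 1] (by simp [Fin.forall_fin_succ])
    (by simp [Fin.forall_fin_succ]) (by norm_num [Fin.sum_univ_succ])
  have h7 := hg ![1, 1, -1, -1] ![-1, 1, -1, -1] (by simp [Fin.forall_fin_succ])
    (by simp [Fin.forall_fin_succ]) (by norm_num [Fin.sum_univ_succ])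
  have h8 := hg ![1, -1, 1, 1] ![1, 1, 1, 1] (by simp [Fin.forall_fin_succ])
    (by simp [Fin.forall_fin_succ]) (by norm_num [Fin.sum_univ_succ])
  have h9 := hg ![1, -1, 1, 1] ![-1, 1, 1, 1] (by simp [Fin.forall_fin_succ])
    (by simp [Fin.forall_fin_succ]) (by norm_num [Fin.sum_univ_succ])
  have h10 := hg ![1, -1, 1, -1] ![-1, 1, 1, -1] (by simp [Fin.forall_fin_succ])
    (by simp [Fin.forall_fin_succ]) (by norm_num [Fin.sum_univ_succ])
  have h11 := hg ![1, -1, 1, -1] ![-1, -1, 1, -1] (by simp [Fin.forall_fin_succ])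
    (by simp [Fin.forall_fin_succ]) (by norm_num [Fin.sum_univ_succ])
  have h12 := hg ![1, -1, -1, 1] ![-1, 1, 1, 1] (by simp [Fin.forall_fin_succ])
    (by simp [Fin.forall_fin_succ]) (by norm_num [Fin.sum_univ_succ])
  have h13 := hg ![1, -1, -1, 1] ![-1, -1, 1, 1] (by simp [Fin.forall_fin_succ])
    (by simp [Fin.forall_fin_succ]) (by norm_num [Fin.sum_univ_succ])
  have h14 := hg ![1, -1, -1, -1] ![-1, -1, 1, 1] (by simp [Fin.forall_fin_succ])
    (by simp [Fin.forall_fin_succ]) (by norm_num [Fin.sum_univ_succ])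
  have h15 := hg ![1, -1, -1, -1] ![-1, -1, -1, 1] (by simp [Fin.forall_fin_succ])
    (by simp [Fin.forall_fin_succ]) (by norm_num [Fin.sum_univ_succ])
  simp only [Fin.sum_univ_four, Matrix.cons_val, mul_one, mul_neg, neg_neg]
    at h0 h1 h2 h3 h4 h5 h6 h7 h8 h9 h10 h11 h12 h13 h14 h15
  ext i j
  fin_cases i <;> fin_cases j <;> simp <;> linarith

/-- Gisin's first `(4,4)` correlation inequality is facet-inducing for
`Cut(K_{4,4})`. -/
theorem gisin1_isFacet :
    IsFacet 4 4
      ![![-2, 2, 1, 1], ![1, 2, -2, -1], ![1, 1, 2, -2], ![2, 1, 1, 2]]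
      10 := by
  have hne : gisin1 ≠ 0 := fun h => by simpa using congrFun (congrFun h 0) 0
  refine ⟨hne, fun x hx => ?_, ?_⟩
  · have hconv : Convex ℝ {x | arrayPairing gisin1 x ≤ 10} :=
      convex_halfSpace_le (arrayPairing gisin1).isLinear 10
    have hsub : cutVectorsK 4 4 ⊆ {x | arrayPairing gisin1 x ≤ 10} := by
      rintro _ ⟨a, b, ha, hb, rfl⟩
      simpa only [Set.mem_ofPred_eq, arrayPairing_apply] using gisin1_le ha hb
    simpa only [Set.mem_ofPred_eq, arrayPairing_apply] using convexHull_min hsub hconv hx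
  · have hφ : arrayPairing gisin1 ≠ 0 := fun h => by
      have := LinearMap.congr_fun h (Pi.single 0 (Pi.single 0 1))
      simp [arrayPairing_apply, Fin.sum_univ_four] at this
    rw [finrank_direction_affineSpan_of_dual hφ (k := 10)
      (fun x hx => (arrayPairing_apply _ x).trans hx.2)]
    · simp [finrank_pi_fintype]
    intro f hf
    obtain ⟨g, rfl⟩ := exists_eq_arrayPairing f
    have hone : (fun _ _ => 1 * 1 : Fin 4 → Fin 4 → ℝ) ∈ {x ∈ cutVectorsK 4 4 |
        ∑ i, ∑ j, gisin1 i j * x i j = 10} :=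
      ⟨⟨fun _ => 1, fun _ => 1, by simp, by simp, rfl⟩, by norm_num [Fin.sum_univ_succ]⟩
    have hg := eq_smul_gisin1 (g := g) fun a b ha hb hab =>
      (arrayPairing_apply g _).symm.trans (hf _ ⟨⟨a, b, ha, hb, rfl⟩, hab⟩ _ hone)
    exact ⟨_, (arrayPairing_smul _ _).symm.trans (congrArg arrayPairing hg.symm)⟩
end

section
/- Let x ∈ ℝ^{2×2} with x_{ij} ∈ [−1,1] for all 1 ≤ i, j ≤ 2. Then x belongs to the elliptope E(K_{2,2}) if and only if the vector y ∈ ℝ^{2×2} defined by y_{ij} = (2/π)·arcsin(x_{ij}) belongs to the cut polytope Cut(K_{2,2}). -/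
open Finset

/-- The elliptope `E(K_{2,2})`: vectors realized by inner products of unit
vectors `u_1, u_2, v_1, v_2` in `ℝ^4`. -/
def EllK22 : Set (Fin 2 → Fin 2 → ℝ) :=
  {x | ∃ (u : Fin 2 → (Fin 4 → ℝ)) (v : Fin 2 → (Fin 4 → ℝ)),
      (∀ i, ∑ k, u i k * u i k = 1) ∧ (∀ j, ∑ k, v j k * v j k = 1) ∧
      (∀ i j, x i j = ∑ k, u i k * v j k)}

/-- The cut polytope `Cut(K_{2,2})`. -/
def CutK22 : Set (Fin 2 → Fin 2 → ℝ) :=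
  convexHull ℝ
    {x | ∃ (a : Fin 2 → ℝ) (b : Fin 2 → ℝ),
      (∀ i, a i = 1 ∨ a i = -1) ∧ (∀ j, b j = 1 ∨ b j = -1) ∧
      x = fun i j => a i * b j}

/-- The cut polytope of `K_{2,2}` is cut out by the box constraints and the CHSH inequalities. -/
theorem mem_CutK22_iff (y : Fin 2 → Fin 2 → ℝ) :
    y ∈ CutK22 ↔ (∀ i j, |y i j| ≤ 1) ∧
      |y 0 0 + y 0 1 + y 1 0 - y 1 1| ≤ 2 ∧ |y 0 0 + y 0 1 - y 1 0 + y 1 1| ≤ 2 ∧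
      |y 0 0 - y 0 1 + y 1 0 + y 1 1| ≤ 2 ∧ |-y 0 0 + y 0 1 + y 1 0 + y 1 1| ≤ 2 := by
  constructor
  · intro h
    have hconv : Convex ℝ {y : Fin 2 → Fin 2 → ℝ | (∀ i j, |y i j| ≤ 1) ∧
      |y 0 0 + y 0 1 + y 1 0 - y 1 1| ≤ 2 ∧ |y 0 0 + y 0 1 - y 1 0 + y 1 1| ≤ 2 ∧
      |y 0 0 - y 0 1 + y 1 0 + y 1 1| ≤ 2 ∧ |-y 0 0 + y 0 1 + y 1 0 + y 1 1| ≤ 2} := by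
      have key (p q a b c : ℝ) (ha : 0 ≤ a) (hb : 0 ≤ b) (hab : a + b = 1)
          (hp : |p| ≤ c) (hq : |q| ≤ c) : |a * p + b * q| ≤ c := by
        have := convex_Icc (-c) c (abs_le.1 hp) (abs_le.1 hq) ha hb hab
        exact abs_le.2 this
      rintro p ⟨p0, p1, p2, p3, p4⟩ q ⟨q0, q1, q2, q3, q4⟩ a b ha hb hab
      refine ⟨fun i j => key _ _ a b 1 ha hb hab (p0 i j) (q0 i j), ?_, ?_, ?_, ?_⟩
      · convert key _ _ a b 2 ha hb hab p1 q1 using 2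
        simp only [Pi.add_apply, Pi.smul_apply, smul_eq_mul]; ring
      · convert key _ _ a b 2 ha hb hab p2 q2 using 2
        simp only [Pi.add_apply, Pi.smul_apply, smul_eq_mul]; ring
      · convert key _ _ a b 2 ha hb hab p3 q3 using 2
        simp only [Pi.add_apply, Pi.smul_apply, smul_eq_mul]; ring
      · convert key _ _ a b 2 ha hb hab p4 q4 using 2
        simp only [Pi.add_apply, Pi.smul_apply, smul_eq_mul]; ring
    refine convexHull_min ?_ hconv h
    rintro _ ⟨a, b, ha, hb, rfl⟩
    refine ⟨fun i j => ?_, ?_⟩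
    · rcases ha i with h | h <;> rcases hb j with h' | h' <;> norm_num [h, h']
    · rcases ha 0 with h | h <;> rcases hb 0 with h' | h' <;> rcases ha 1 with k | k <;>
        rcases hb 1 with k' | k' <;> norm_num [h, h', k, k']
  · rintro ⟨h0, h1, h2, h3, h4⟩
    have h00 := abs_le.1 (h0 0 0)
    have h01 := abs_le.1 (h0 0 1)
    have h10 := abs_le.1 (h0 1 0)
    have h11 := abs_le.1 (h0 1 1)
    rw [abs_le] at h1 h2 h3 h4
    -- The eight cut vectors are `±` the elements of an orthogonal basis.
    have hv (σ a b : ℝ) (hσ : σ = 1 ∨ σ = -1) (ha : a = 1 ∨ a = -1) (hb : b = 1 ∨ b = -1) :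
        (fun i j => ![σ, σ * a] i * ![1, b] j : Fin 2 → Fin 2 → ℝ) ∈ CutK22 := by
      refine subset_convexHull ℝ _ ⟨_, _, ?_, ?_, rfl⟩
      · intro i
        fin_cases i
        · simpa using hσ
        · rcases hσ with rfl | rfl <;> rcases ha with rfl | rfl <;> norm_num
      · intro j
        fin_cases j
        · simp
        · simpa using hb
    have hC : Convex ℝ CutK22 := convex_convexHull ℝ _
    let ε : Fin 2 → ℝ := ![1, -1]
    have hε (i) : ε i = 1 ∨ ε i = -1 := by fin_cases i <;> simp [ε]
    let c : Fin 2 → Fin 2 → ℝ := fun k l =>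
      (y 0 0 + ε l * y 0 1 + ε k * y 1 0 + ε k * ε l * y 1 1) / 4
    have hsum : |c 0 0| + |c 0 1| + |c 1 0| + |c 1 1| ≤ 1 := by
      simp only [c, ε, Matrix.cons_val_zero, Matrix.cons_val_one]
      rcases abs_cases ((y 0 0 + 1 * y 0 1 + 1 * y 1 0 + 1 * 1 * y 1 1) / 4) with h | h <;>
      rcases abs_cases ((y 0 0 + -1 * y 0 1 + 1 * y 1 0 + 1 * -1 * y 1 1) / 4) with h' | h' <;>
      rcases abs_cases ((y 0 0 + 1 * y 0 1 + -1 * y 1 0 + -1 * 1 * y 1 1) / 4) with k | k <;>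
      rcases abs_cases ((y 0 0 + -1 * y 0 1 + -1 * y 1 0 + -1 * -1 * y 1 1) / 4) with k' | k' <;>
      rw [h.1, h'.1, k.1, k'.1] <;> linarith
    let w : Fin 2 × Fin 2 × Fin 2 → ℝ := fun t =>
      (|c t.2.1 t.2.2| + ε t.1 * c t.2.1 t.2.2) / 2
        + (1 - (|c 0 0| + |c 0 1| + |c 1 0| + |c 1 1|)) / 8
    have hw : ∀ t, 0 ≤ w t := by
      rintro ⟨s, k, l⟩
      have h1 := neg_abs_le (c k l)
      have h2 := le_abs_self (c k l)
      rcases hε s with h | h <;> simp only [w, h] <;> linarith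
    have hmem := hC.sum_mem (t := Finset.univ) (w := w)
      (z := fun t => fun i j => ![ε t.1, ε t.1 * ε t.2.1] i * ![1, ε t.2.2] j)
      (fun t _ => hw t)
      (by simp only [Fintype.sum_prod_type, Fin.sum_univ_two, w, ε, Matrix.cons_val_zero,
            Matrix.cons_val_one]; ring)
      (fun t _ => hv _ _ _ (hε _) (hε _) (hε _))
    convert hmem using 1
    ext i j
    simp only [Finset.sum_apply, Pi.smul_apply, smul_eq_mul, Fintype.sum_prod_type,
      Fin.sum_univ_two]
    fin_cases i <;> fin_cases j <;> simp [w, ε, c] <;> ring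

theorem exists_unit_vector_of_gram (a b z : ℝ) (ha : |a| ≤ 1) (hz : |z| ≤ 1)
    (h : (z - a * b) ^ 2 ≤ (1 - a ^ 2) * (1 - b ^ 2)) :
    ∃ u : Fin 4 → ℝ, ∑ k, u k * u k = 1 ∧ ∑ k, u k * ![1, 0, 0, 0] k = a ∧
      ∑ k, u k * ![z, √(1 - z ^ 2), 0, 0] k = b := by
  have hz' : 0 ≤ 1 - z ^ 2 := by nlinarith [(sq_le_one_iff_abs_le_one z).2 hz]
  have ha' : 0 ≤ 1 - a ^ 2 := by nlinarith [(sq_le_one_iff_abs_le_one a).2 ha]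
  set s := √(1 - z ^ 2) with hs
  have hss : s ^ 2 = 1 - z ^ 2 := Real.sq_sqrt hz'
  obtain ⟨p, hp, hp'⟩ : ∃ p : ℝ, a * z + p * s = b ∧ p ^ 2 ≤ 1 - a ^ 2 := by
    by_cases h0 : s = 0
    · have hz1 : z ^ 2 = 1 := by rw [h0] at hss; linarith
      refine ⟨0, ?_, by simpa using ha'⟩
      have : (a * z - b) ^ 2 ≤ 0 := by nlinarith
      have := pow_eq_zero_iff two_ne_zero |>.1 (le_antisymm this (sq_nonneg _))
      linarith
    · refine ⟨(b - a * z) / s, by field_simp; ring, ?_⟩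
      have : 0 < s ^ 2 := by positivity
      rw [div_pow, div_le_iff₀ this, hss]
      nlinarith
  refine ⟨![a, p, √(1 - a ^ 2 - p ^ 2), 0], ?_, ?_, ?_⟩
  · have := Real.mul_self_sqrt (sub_nonneg.2 hp')
    simp [Fin.sum_univ_four, this]; ring
  · simp [Fin.sum_univ_four]
  · simpa [Fin.sum_univ_four] using hp

theorem cos_add_le_cos_sub {α β γ δ : ℝ} (h1 : γ ≤ α + β + δ) (h2 : δ ≤ α + β + γ)
    (h3 : α + β + γ - δ ≤ 2 * Real.pi) (h4 : α + β + δ - γ ≤ 2 * Real.pi) :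
    Real.cos (α + β) ≤ Real.cos (γ - δ) := by
  rw [← Real.cos_abs (γ - δ)]
  have l : |γ - δ| ≤ α + β := abs_le.2 ⟨by linarith, by linarith⟩
  have l' : |γ - δ| ≤ 2 * Real.pi - (α + β) := abs_le.2 ⟨by linarith, by linarith⟩
  rcases le_total (α + β) Real.pi with h | h
  · exact Real.cos_le_cos_of_nonneg_of_le_pi (abs_nonneg _) h l
  · rw [← Real.cos_two_pi_sub (α + β)]
    exact Real.cos_le_cos_of_nonneg_of_le_pi (abs_nonneg _) (by linarith) l'

theorem sq_sub_cos_mul_cos_le {α β z : ℝ} (h1 : Real.cos (α + β) ≤ z)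
    (h2 : z ≤ Real.cos (α - β)) :
    (z - Real.cos α * Real.cos β) ^ 2 ≤ (1 - Real.cos α ^ 2) * (1 - Real.cos β ^ 2) := by
  rw [← Real.sin_sq, ← Real.sin_sq, ← mul_pow]
  rw [Real.cos_add] at h1
  rw [Real.cos_sub] at h2
  exact sq_le_sq' (by linarith) (by linarith)

theorem mem_EllK22_of_arccos_le (x : Fin 2 → Fin 2 → ℝ) (hx : ∀ i j, x i j ∈ Set.Icc (-1 : ℝ) 1)
    (h : ∀ i i' j j', i ≠ i' → j ≠ j' →
      Real.arccos (x i' j') ≤ Real.arccos (x i' j) + Real.arccos (x i j) + Real.arccos (x i j') ∧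
      Real.arccos (x i' j) + Real.arccos (x i j) + Real.arccos (x i j') - Real.arccos (x i' j')
        ≤ 2 * Real.pi) : x ∈ EllK22 := by
  have hcos (i j) : Real.cos (Real.arccos (x i j)) = x i j := Real.cos_arccos (hx i j).1 (hx i j).2
  have ⟨a1, b1⟩ := h 0 1 0 1 (by simp) (by simp)
  have ⟨a2, b2⟩ := h 0 1 1 0 (by simp) (by simp)
  have ⟨a3, b3⟩ := h 1 0 0 1 (by simp) (by simp)
  have ⟨a4, b4⟩ := h 1 0 1 0 (by simp) (by simp)
  have hneg (i j) : 0 ≤ Real.arccos (x i j) := Real.arccos_nonneg _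
  have hpi (i j) : Real.arccos (x i j) ≤ Real.pi := Real.arccos_le_pi _
  have self (i) : Real.cos (Real.arccos (x i 0) + Real.arccos (x i 1)) ≤
      Real.cos (Real.arccos (x i 0) - Real.arccos (x i 1)) := by
    apply cos_add_le_cos_sub <;> linarith [hneg i 0, hneg i 1, hpi i 0, hpi i 1]
  have c01 : Real.cos (Real.arccos (x 0 0) + Real.arccos (x 0 1)) ≤
      Real.cos (Real.arccos (x 1 0) - Real.arccos (x 1 1)) := by
    apply cos_add_le_cos_sub <;> linarith
  have c10 : Real.cos (Real.arccos (x 1 0) + Real.arccos (x 1 1)) ≤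
      Real.cos (Real.arccos (x 0 0) - Real.arccos (x 0 1)) := by
    apply cos_add_le_cos_sub <;> linarith
  obtain ⟨z, hz1, hz⟩ : ∃ z : ℝ, |z| ≤ 1 ∧
      ∀ i, Real.cos (Real.arccos (x i 0) + Real.arccos (x i 1)) ≤ z ∧
        z ≤ Real.cos (Real.arccos (x i 0) - Real.arccos (x i 1)) := by
    refine ⟨max (Real.cos (Real.arccos (x 0 0) + Real.arccos (x 0 1)))
      (Real.cos (Real.arccos (x 1 0) + Real.arccos (x 1 1))), ?_, ?_⟩
    · rcases max_choice (Real.cos (Real.arccos (x 0 0) + Real.arccos (x 0 1)))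
        (Real.cos (Real.arccos (x 1 0) + Real.arccos (x 1 1))) with h | h <;>
      rw [h] <;> exact Real.abs_cos_le_one _
    · rw [Fin.forall_fin_two]
      exact ⟨⟨le_max_left _ _, max_le (self 0) c10⟩, ⟨le_max_right _ _, max_le c01 (self 1)⟩⟩
  have hu (i) := exists_unit_vector_of_gram (x i 0) (x i 1) z (abs_le.2 (hx i 0))
    hz1 (by
      have := sq_sub_cos_mul_cos_le (hz i).1 (hz i).2
      rwa [hcos, hcos] at this)
  choose u hu1 hu2 hu3 using hu
  refine ⟨u, ![![1, 0, 0, 0], ![z, √(1 - z ^ 2), 0, 0]], hu1, ?_, ?_⟩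
  · have : 0 ≤ 1 - z ^ 2 := by nlinarith [(sq_le_one_iff_abs_le_one z).2 hz1]
    rw [Fin.forall_fin_two]
    constructor
    · simp [Fin.sum_univ_four]
    · simp [Fin.sum_univ_four, Real.mul_self_sqrt this]; ring
  · intro i
    rw [Fin.forall_fin_two]
    exact ⟨(hu2 i).symm, (hu3 i).symm⟩

open InnerProductGeometry in
theorem arccos_le_of_mem_EllK22 {x : Fin 2 → Fin 2 → ℝ} (h : x ∈ EllK22) (i i' j j' : Fin 2) :
    Real.arccos (x i' j') ≤ Real.arccos (x i' j) + Real.arccos (x i j) + Real.arccos (x i j') ∧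
    Real.arccos (x i' j) + Real.arccos (x i j) + Real.arccos (x i j') - Real.arccos (x i' j')
      ≤ 2 * Real.pi := by
  obtain ⟨u, v, hu, hv, hx⟩ := h
  have hnorm (w : Fin 4 → ℝ) (hw : ∑ k, w k * w k = 1) : ‖WithLp.toLp 2 w‖ = 1 := by
    rw [EuclideanSpace.norm_eq]
    simp [sq, hw]
  have hang (i j) : Real.arccos (x i j) = angle (WithLp.toLp 2 (u i)) (WithLp.toLp 2 (v j)) := by
    rw [angle, hnorm _ (hu i), hnorm _ (hv j), hx]
    simp [PiLp.inner_apply, mul_comm]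
  have tri (a b c d : EuclideanSpace ℝ (Fin 4)) : angle a d ≤ angle a b + angle b c + angle c d :=
    (angle_le_angle_add_angle a c d).trans (by gcongr; exact angle_le_angle_add_angle a b c)
  have e1 := tri (WithLp.toLp 2 (u i')) (WithLp.toLp 2 (v j)) (WithLp.toLp 2 (u i))
    (WithLp.toLp 2 (v j'))
  have e2 := tri (WithLp.toLp 2 (u i)) (-WithLp.toLp 2 (v j)) (WithLp.toLp 2 (u i'))
    (WithLp.toLp 2 (v j'))
  rw [angle_neg_right, angle_neg_left] at e2
  rw [angle_comm (WithLp.toLp 2 (v j))] at e1 e2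
  simp only [hang]
  constructor <;> linarith

/-- Tsirelson's conjecture for `(2,2)` settings (proved via Laurent's theorem
on the cut condition): a vector `x ∈ [−1,1]^{2×2}` belongs to the elliptope
`E(K_{2,2})` if and only if `(2/π)·arcsin x` belongs to `Cut(K_{2,2})`. -/
theorem elliptope_iff_arcsin_mem_cut (x : Fin 2 → Fin 2 → ℝ)
    (hx : ∀ i j, x i j ∈ Set.Icc (-1 : ℝ) 1) :
    x ∈ EllK22 ↔ (fun i j => 2 / Real.pi * Real.arcsin (x i j)) ∈ CutK22 := by
  have hpi := Real.pi_pos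
  have hs (t c : ℝ) : |2 / Real.pi * t| ≤ c ↔ -(c * Real.pi / 2) ≤ t ∧ t ≤ c * Real.pi / 2 := by
    rw [abs_mul, abs_of_pos (by positivity : 0 < 2 / Real.pi), ← abs_le, div_mul_eq_mul_div,
      div_le_iff₀ hpi, le_div_iff₀ two_pos, mul_comm]
  rw [mem_CutK22_iff]
  simp only [← mul_neg, ← mul_add, ← mul_sub, hs]
  constructor
  · intro h
    have ⟨a1, b1⟩ := arccos_le_of_mem_EllK22 h 0 1 0 1
    have ⟨a2, b2⟩ := arccos_le_of_mem_EllK22 h 0 1 1 0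
    have ⟨a3, b3⟩ := arccos_le_of_mem_EllK22 h 1 0 0 1
    have ⟨a4, b4⟩ := arccos_le_of_mem_EllK22 h 1 0 1 0
    simp only [Real.arccos] at a1 a2 a3 a4 b1 b2 b3 b4
    refine ⟨fun i j => ?_, ?_, ?_, ?_, ?_⟩
    · have h1 := Real.neg_pi_div_two_le_arcsin (x i j)
      have h2 := Real.arcsin_le_pi_div_two (x i j)
      constructor <;> linarith
    all_goals constructor <;> linarith
  · rintro ⟨-, ⟨a1, b1⟩, ⟨a2, b2⟩, ⟨a3, b3⟩, ⟨a4, b4⟩⟩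
    refine mem_EllK22_of_arccos_le x hx fun i i' j j' hi hj => ?_
    simp only [Real.arccos]
    fin_cases i <;> fin_cases i' <;> fin_cases j <;> fin_cases j' <;> simp at hi hj ⊢ <;>
      constructor <;> linarith
end
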